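/- arXiv:0804.3493 — 3 statements merged into one kernel-verified Lean document; each statement's English description precedes it below -/
import Mathlib

section
/- Let G be an affine algebraic supergroup over a field K with coordinate Hopf superalgebra K[G], and let H be a closed supersubgroup that is normal (satisfies the right normality condition). Then R = K[G]^H, the subalgebra of right H-invariants of K[G], is a Hopf supersubalgebra of K[G]; in particular the antipode of K[G] restricts to R. -/
open TensorProduct

/-- The signed braiding `a ⊗ b ↦ (-1)^{|a||b|} b ⊗ a` on `A ⊗ A` for a
`ℤ/2`-graded algebra `A`. -/
noncomputable def superSwap {K A : Type} [Field K] [Ring A] [Algebra K A]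
    (𝒜 : ZMod 2 → Submodule K A) [GradedAlgebra 𝒜] :
    A ⊗[K] A →ₗ[K] A ⊗[K] A :=
  ∑ p : ZMod 2 × ZMod 2, ((-1 : K) ^ (p.1.val * p.2.val)) •
    ((TensorProduct.comm K A A).toLinearMap ∘ₗ
      TensorProduct.map (GradedAlgebra.proj 𝒜 p.1) (GradedAlgebra.proj 𝒜 p.2))

/-- The super multiplication on `A ⊗ A`:
`(a ⊗ b) ⊗ (c ⊗ d) ↦ (-1)^{|b||c|} (ac) ⊗ (bd)`. -/
noncomputable def superMulAA {K A : Type} [Field K] [Ring A] [Algebra K A]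
    (𝒜 : ZMod 2 → Submodule K A) [GradedAlgebra 𝒜] :
    (A ⊗[K] A) ⊗[K] (A ⊗[K] A) →ₗ[K] A ⊗[K] A :=
  TensorProduct.map (LinearMap.mul' K A) (LinearMap.mul' K A) ∘ₗ
    (TensorProduct.assoc K A A (A ⊗[K] A)).symm.toLinearMap ∘ₗ
    TensorProduct.map LinearMap.id (TensorProduct.assoc K A A A).toLinearMap ∘ₗ
    TensorProduct.map LinearMap.id (TensorProduct.map (superSwap 𝒜) LinearMap.id) ∘ₗ
    TensorProduct.map LinearMap.id (TensorProduct.assoc K A A A).symm.toLinearMap ∘ₗ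
    (TensorProduct.assoc K A A (A ⊗[K] A)).toLinearMap

/-- A (supercommutative) Hopf superalgebra structure on a `ℤ/2`-graded algebra `A`:
comultiplication, counit and antipode, satisfying the Hopf superalgebra axioms, where
the compatibility of the comultiplication with the product uses the sign rule. -/
structure SuperHopf (K A : Type) [Field K] [Ring A] [Algebra K A]
    (𝒜 : ZMod 2 → Submodule K A) [GradedAlgebra 𝒜] where
  comul : A →ₗ[K] A ⊗[K] A
  counit : A →ₗ[K] K
  antipode : A →ₗ[K] A
  coassoc : (TensorProduct.assoc K A A A).toLinearMap ∘ₗ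
      TensorProduct.map comul LinearMap.id ∘ₗ comul
      = TensorProduct.map LinearMap.id comul ∘ₗ comul
  counit_left : (TensorProduct.lid K A).toLinearMap ∘ₗ
      TensorProduct.map counit LinearMap.id ∘ₗ comul = LinearMap.id
  counit_right : (TensorProduct.rid K A).toLinearMap ∘ₗ
      TensorProduct.map LinearMap.id counit ∘ₗ comul = LinearMap.id
  comul_one : comul 1 = (1 : A) ⊗ₜ[K] 1
  counit_one : counit 1 = 1
  comul_mul : comul ∘ₗ LinearMap.mul' K A
      = superMulAA 𝒜 ∘ₗ TensorProduct.map comul comul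
  counit_mul : ∀ a b : A, counit (a * b) = counit a * counit b
  antipode_left : LinearMap.mul' K A ∘ₗ
      TensorProduct.map antipode LinearMap.id ∘ₗ comul
      = Algebra.linearMap K A ∘ₗ counit
  antipode_right : LinearMap.mul' K A ∘ₗ
      TensorProduct.map LinearMap.id antipode ∘ₗ comul
      = Algebra.linearMap K A ∘ₗ counit
  comul_graded : ∀ (i : ZMod 2) (x : A), x ∈ 𝒜 i →
      comul x ∈ ⨆ j : ZMod 2, LinearMap.range
        (TensorProduct.map ((𝒜 j).subtype) ((𝒜 (i - j)).subtype))
  antipode_graded : ∀ (i : ZMod 2) (x : A), x ∈ 𝒜 i → antipode x ∈ 𝒜 i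


section Helpers

open GradedTensorProduct WithConv

variable {K A : Type} [Field K] [Ring A] [Algebra K A]
    (𝒜 : ZMod 2 → Submodule K A) [GradedAlgebra 𝒜]

/-- sign -/
abbrev sgn (K : Type) [Field K] (i j : ZMod 2) : K := (-1 : K) ^ (i.val * j.val)

abbrev pj (i : ZMod 2) : A →ₗ[K] A := GradedAlgebra.proj 𝒜 i

lemma sgn_units {M : Type} [AddCommGroup M] [Module K M] (i j : ZMod 2) (x : M) :
    ((-1 : ℤˣ) ^ (i * j)) • x = sgn K i j • x := by
  have h : ∀ i : ZMod 2, i = 0 ∨ i = 1 := by decide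
  rcases h i with rfl | rfl
  · simp [sgn]
  rcases h j with rfl | rfl
  · simp [sgn]
  · rw [mul_one, uzpow_one]
    have : (1 : ZMod 2).val = 1 := rfl
    simp [sgn, this]

lemma pj_mem (i : ZMod 2) (x : A) : pj 𝒜 i x ∈ 𝒜 i := by
  simp [pj, GradedAlgebra.proj_apply]

lemma pj_same {i : ZMod 2} {x : A} (h : x ∈ 𝒜 i) : pj 𝒜 i x = x := by
  simp [pj, GradedAlgebra.proj_apply, DirectSum.decompose_of_mem_same _ h]

lemma pj_ne {i j : ZMod 2} {x : A} (h : x ∈ 𝒜 i) (hij : i ≠ j) : pj 𝒜 j x = 0 := by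
  simp [pj, GradedAlgebra.proj_apply, DirectSum.decompose_of_mem_ne _ h hij]

lemma pj_sum (x : A) : ∑ i, pj 𝒜 i x = x := by
  classical
  conv_rhs => rw [← DirectSum.sum_support_decompose 𝒜 x]
  symm
  apply Finset.sum_subset (Finset.subset_univ _)
  intro i _ hi
  simpa using hi

lemma hom_ind {p : A → Prop} (hadd : ∀ x y, p x → p y → p (x + y))
    (h : ∀ i, ∀ x ∈ 𝒜 i, p x) (x : A) : p x := by
  rw [← pj_sum 𝒜 x, show (Finset.univ : Finset (ZMod 2)) = {0, 1} from rfl,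
    Finset.sum_pair (by decide)]
  exact hadd _ _ (h _ _ (pj_mem 𝒜 _ _)) (h _ _ (pj_mem 𝒜 _ _))

lemma sum_pj_smul {M : Type} [AddCommGroup M] [Module K M] {i : ZMod 2} {x : A} (h : x ∈ 𝒜 i)
    (F : ZMod 2 → A →ₗ[K] M) : ∑ j, F j (pj 𝒜 j x) = F i x := by
  rw [Finset.sum_eq_single i]
  · rw [pj_same 𝒜 h]
  · intro b _ hb; rw [pj_ne 𝒜 h hb.symm, map_zero]
  · simp

abbrev CC := GradedTensorProduct K 𝒜 𝒜

noncomputable abbrev i1 : A →ₐ[K] CC 𝒜 := includeLeft 𝒜 𝒜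
noncomputable abbrev i2 : A →ₐ[K] CC 𝒜 := includeRight 𝒜 𝒜

lemma i1_mul_i2 (a b : A) : i1 𝒜 a * i2 𝒜 b = of K 𝒜 𝒜 (a ⊗ₜ b) :=
  tmul_one_mul_one_tmul 𝒜 𝒜 a b

lemma gmul_hom {i j : ZMod 2} (a b c d : A) (hb : b ∈ 𝒜 j) (hc : c ∈ 𝒜 i) :
    of K 𝒜 𝒜 (a ⊗ₜ b) * of K 𝒜 𝒜 (c ⊗ₜ d) = sgn K j i • of K 𝒜 𝒜 ((a * c) ⊗ₜ (b * d)) := by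
  have := tmul_coe_mul_coe_tmul (R := K) 𝒜 𝒜 a ⟨b, hb⟩ ⟨c, hc⟩ d
  rw [sgn_units (K := K)] at this
  exact this

lemma gmul (a b c d : A) :
    of K 𝒜 𝒜 (a ⊗ₜ b) * of K 𝒜 𝒜 (c ⊗ₜ d) =
      ∑ j, ∑ i, sgn K j i • of K 𝒜 𝒜 ((a * pj 𝒜 i c) ⊗ₜ (pj 𝒜 j b * d)) := by
  induction b using hom_ind 𝒜 with
  | hadd x y hx hy =>
    simp only [TensorProduct.tmul_add, map_add, add_mul, smul_add, Finset.sum_add_distrib, hx, hy]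
  | h j b hb =>
  induction c using hom_ind 𝒜 with
  | hadd x y hx hy =>
    simp only [TensorProduct.add_tmul, map_add, mul_add, smul_add, Finset.sum_add_distrib, hx, hy]
  | h i c hc =>
  rw [gmul_hom 𝒜 _ _ _ _ hb hc, Finset.sum_eq_single j, Finset.sum_eq_single i, pj_same 𝒜 hb,
    pj_same 𝒜 hc]
  · intro i' _ h; rw [pj_ne 𝒜 hc h.symm]; simp
  · simp
  · intro i' _ h; rw [pj_ne 𝒜 hb h.symm]; simp
  · simp

lemma gmul_eq_super (x y : A ⊗[K] A) :
    of K 𝒜 𝒜 x * of K 𝒜 𝒜 y = of K 𝒜 𝒜 (superMulAA 𝒜 (x ⊗ₜ y)) := by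
  induction x with
  | zero => simp
  | add x x' h h' => simp only [map_add, add_mul, TensorProduct.add_tmul, h, h']
  | tmul a b =>
    induction y with
    | zero => simp
    | add x x' h h' => simp only [map_add, mul_add, TensorProduct.tmul_add, h, h']
    | tmul c d =>
      rw [gmul]
      simp only [superMulAA, superSwap, LinearMap.comp_apply, LinearEquiv.coe_coe,
        TensorProduct.assoc_tmul, TensorProduct.map_tmul, TensorProduct.assoc_symm_tmul,
        LinearMap.id_apply, LinearMap.sum_apply, LinearMap.smul_apply, TensorProduct.comm_tmul,
        TensorProduct.sum_tmul, TensorProduct.tmul_sum, map_sum, Fintype.sum_prod_type,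
        ← TensorProduct.smul_tmul', TensorProduct.tmul_smul, map_smul, LinearMap.mul'_apply]

lemma tri_form (a b c : A) : i2 𝒜 a * i1 𝒜 b * i2 𝒜 c =
    ∑ j, ∑ i, sgn K j i • of K 𝒜 𝒜 ((pj 𝒜 i b) ⊗ₜ (pj 𝒜 j a * c)) := by
  have h1 : i2 𝒜 a * i1 𝒜 b = of K 𝒜 𝒜 (1 ⊗ₜ a) * of K 𝒜 𝒜 (b ⊗ₜ 1) := rfl
  rw [h1, gmul]
  simp only [mul_one, one_mul, Finset.sum_mul, smul_mul_assoc]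
  refine Finset.sum_congr rfl fun j _ => Finset.sum_congr rfl fun i _ => ?_
  rw [← i1_mul_i2, mul_assoc, ← map_mul, i1_mul_i2]

namespace SuperHopf

variable {𝒜} (H : SuperHopf K A 𝒜)

@[reducible] noncomputable def coalg : Coalgebra K A where
  comul := H.comul
  counit := H.counit
  coassoc := H.coassoc
  rTensor_counit_comp_comul := by
    ext x
    apply (TensorProduct.lid K A).injective
    have := LinearMap.congr_fun H.counit_left x
    simpa [LinearMap.rTensor] using this
  lTensor_counit_comp_comul := by
    ext x
    apply (TensorProduct.rid K A).injective
    have := LinearMap.congr_fun H.counit_right x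
    simpa [LinearMap.lTensor] using this

/-- Convolution. -/
noncomputable def conv {T : Type} [Ring T] [Algebra K T] (u v : A →ₗ[K] T) : A →ₗ[K] T :=
  LinearMap.mul' K T ∘ₗ TensorProduct.map u v ∘ₗ H.comul

noncomputable def cone (T : Type) [Ring T] [Algebra K T] : A →ₗ[K] T :=
  Algebra.linearMap K T ∘ₗ H.counit

variable {T : Type} [Ring T] [Algebra K T]

lemma conv_assoc (u v w : A →ₗ[K] T) : H.conv (H.conv u v) w = H.conv u (H.conv v w) := by
  let _ := H.coalg
  exact congrArg WithConv.ofConv (mul_assoc (toConv u) (toConv v) (toConv w))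

lemma cone_conv (u : A →ₗ[K] T) : H.conv (H.cone T) u = u := by
  let _ := H.coalg
  exact congrArg WithConv.ofConv (one_mul (toConv u))

lemma conv_cone (u : A →ₗ[K] T) : H.conv u (H.cone T) = u := by
  let _ := H.coalg
  exact congrArg WithConv.ofConv (mul_one (toConv u))

lemma cancel {u v w w' : A →ₗ[K] T} (hw : H.conv w w' = H.cone T)
    (h : H.conv u w = H.conv v w) : u = v := by
  rw [← H.conv_cone u, ← hw, ← conv_assoc, h, conv_assoc, hw, conv_cone]

lemma inv_unique {u v w : A →ₗ[K] T} (h : H.conv u w = H.cone T)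
    (hw : H.conv w v = H.cone T) : u = v := by
  rw [← H.conv_cone u, ← hw, ← conv_assoc, h, cone_conv]

lemma algHom_conv {T' : Type} [Ring T'] [Algebra K T'] (φ : T →ₐ[K] T') (u v : A →ₗ[K] T) :
    φ.toLinearMap ∘ₗ H.conv u v = H.conv (φ.toLinearMap ∘ₗ u) (φ.toLinearMap ∘ₗ v) := by
  let _ := H.coalg
  exact LinearMap.algHom_comp_convMul_distrib φ (toConv u) (toConv v)

lemma algHom_cone {T' : Type} [Ring T'] [Algebra K T'] (φ : T →ₐ[K] T') :
    φ.toLinearMap ∘ₗ H.cone T = H.cone T' := by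
  ext x; simp [cone]

lemma conv_id_s : H.conv LinearMap.id H.antipode = H.cone A := H.antipode_right
lemma conv_s_id : H.conv H.antipode LinearMap.id = H.cone A := H.antipode_left

lemma conv_phi_s (φ : A →ₐ[K] T) :
    H.conv φ.toLinearMap (φ.toLinearMap ∘ₗ H.antipode) = H.cone T := by
  have := H.algHom_conv φ LinearMap.id H.antipode
  rw [conv_id_s, algHom_cone] at this
  exact this.symm

lemma conv_s_phi (φ : A →ₐ[K] T) :
    H.conv (φ.toLinearMap ∘ₗ H.antipode) φ.toLinearMap = H.cone T := by
  have := H.algHom_conv φ H.antipode LinearMap.id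
  rw [conv_s_id, algHom_cone] at this
  exact this.symm

lemma antipode_one : H.antipode 1 = 1 := by
  have := LinearMap.congr_fun H.antipode_left 1
  simpa [H.comul_one, H.counit_one] using this

lemma antipode_pj (i : ZMod 2) (x : A) : H.antipode (pj 𝒜 i x) = pj 𝒜 i (H.antipode x) := by
  induction x using hom_ind 𝒜 with
  | hadd x y hx hy => simp only [map_add, hx, hy]
  | h j x hx =>
    by_cases h : j = i
    · subst h; rw [pj_same 𝒜 hx, pj_same 𝒜 (H.antipode_graded _ _ hx)]
    · rw [pj_ne 𝒜 hx h, pj_ne 𝒜 (H.antipode_graded _ _ hx) h, map_zero]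

end SuperHopf

/-- sign twist -/
noncomputable def sgl (j : ZMod 2) : A →ₗ[K] A := ∑ i, sgn K i j • pj 𝒜 i

lemma sgl_hom {i : ZMod 2} (j : ZMod 2) {x : A} (hx : x ∈ 𝒜 i) : sgl 𝒜 j x = sgn K i j • x := by
  simp only [sgl, LinearMap.sum_apply, LinearMap.smul_apply]
  exact sum_pj_smul 𝒜 hx (fun i => sgn K i j • LinearMap.id)

lemma sgn_add (i i' j : ZMod 2) : sgn K (i + i') j = sgn K i j * sgn K i' j := by
  have h : ∀ i : ZMod 2, i = 0 ∨ i = 1 := by decide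
  have h1 : (1 : ZMod 2).val = 1 := rfl
  have h2 : (1 + 1 : ZMod 2).val = 0 := rfl
  rcases h i with rfl | rfl <;> rcases h i' with rfl | rfl <;> rcases h j with rfl | rfl <;>
    simp [sgn, h1, h2]

lemma sgn_comm (i j : ZMod 2) : sgn K i j = sgn K j i := by simp [sgn, mul_comm]

lemma sgn_mul_self (i j : ZMod 2) : sgn K i j * sgn K i j = 1 := by
  simp [sgn, ← mul_pow]

noncomputable def sg (j : ZMod 2) : A →ₐ[K] A :=
  AlgHom.ofLinearMap (sgl 𝒜 j)
    (by rw [sgl_hom 𝒜 j SetLike.GradedOne.one_mem]; simp [sgn])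
    (by
      intro x y
      induction x using hom_ind 𝒜 with
      | hadd x x' hx hx' => simp only [map_add, add_mul, hx, hx']
      | h i x hx =>
      induction y using hom_ind 𝒜 with
      | hadd x x' hx hx' => simp only [map_add, mul_add, hx, hx']
      | h i' y hy =>
      rw [sgl_hom 𝒜 j (SetLike.GradedMul.mul_mem hx hy), sgl_hom 𝒜 j hx, sgl_hom 𝒜 j hy, sgn_add]
      rw [smul_mul_smul_comm])

lemma sg_hom {i : ZMod 2} (j : ZMod 2) {x : A} (hx : x ∈ 𝒜 i) : sg 𝒜 j x = sgn K i j • x :=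
  sgl_hom 𝒜 j hx

lemma sg_apply (j : ZMod 2) (x : A) : sg 𝒜 j x = ∑ i, sgn K i j • pj 𝒜 i x := by
  change sgl 𝒜 j x = _
  simp [sgl]

namespace SuperHopf

variable {𝒜} (H : SuperHopf K A 𝒜)

lemma comul_mul' (x y : A) :
    of K 𝒜 𝒜 (H.comul (x * y)) = of K 𝒜 𝒜 (H.comul x) * of K 𝒜 𝒜 (H.comul y) := by
  rw [gmul_eq_super]
  have := LinearMap.congr_fun H.comul_mul (x ⊗ₜ y)
  simp only [LinearMap.comp_apply, LinearMap.mul'_apply, TensorProduct.map_tmul] at this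
  rw [this]

/-- auxiliary: `V (a ⊗ b) y = ∑ s (a * sg i y) * b_i`. -/
noncomputable def V : A ⊗[K] A →ₗ[K] A →ₗ[K] A :=
  TensorProduct.lift (LinearMap.mk₂ K
    (fun a b => ∑ i, LinearMap.mulRight K (pj 𝒜 i b) ∘ₗ H.antipode ∘ₗ LinearMap.mulLeft K a ∘ₗ
      (sg 𝒜 i).toLinearMap)
    (by intros; ext; simp [add_mul, Finset.sum_add_distrib])
    (by intros; ext; simp [Finset.smul_sum])
    (by intros; ext; simp [mul_add, Finset.sum_add_distrib])
    (by intros; ext; simp [Finset.smul_sum]))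

lemma V_tmul (a b y : A) : H.V (a ⊗ₜ b) y = ∑ i, H.antipode (a * sg 𝒜 i y) * pj 𝒜 i b := by
  simp [V]

lemma V_key (t t' : A ⊗[K] A) :
    LinearMap.mul' K A (TensorProduct.map (H.V t) LinearMap.id t') =
      LinearMap.mul' K A (TensorProduct.map H.antipode LinearMap.id
        ((of K 𝒜 𝒜).symm (of K 𝒜 𝒜 t * of K 𝒜 𝒜 t'))) := by
  induction t with
  | zero => simp
  | add x x' h h' => simp only [map_add, add_mul, TensorProduct.map_add_left,
      LinearMap.add_apply, h, h']
  | tmul a b =>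
    induction t' with
    | zero => simp
    | add x x' h h' => simp only [map_add, mul_add, h, h']
    | tmul c d =>
      rw [gmul]
      simp only [map_sum, map_smul, of_symm_of, TensorProduct.map_tmul, LinearMap.mul'_apply,
        LinearMap.id_apply, V_tmul, sg_apply, Finset.mul_sum, Finset.sum_mul]
      refine Finset.sum_congr rfl fun i _ => Finset.sum_congr rfl fun j _ => ?_
      rw [sgn_comm]
      simp [mul_assoc]

lemma V_comul (x : A) : H.V (H.comul x) = H.counit x • H.antipode := by
  apply H.cancel H.conv_id_s
  ext y
  simp only [conv, LinearMap.comp_apply]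
  rw [V_key, ← comul_mul', of_symm_of]
  have h1 := LinearMap.congr_fun H.antipode_left (x * y)
  have h2 := LinearMap.congr_fun H.antipode_left y
  simp only [LinearMap.comp_apply] at h1 h2
  rw [h1, TensorProduct.map_smul_left, LinearMap.smul_apply, map_smul, h2, H.counit_mul]
  simp [Algebra.smul_def]

lemma antipode_mul_aux {j : ZMod 2} (x y : A) (hy : y ∈ 𝒜 j) :
    H.antipode (x * y) = H.antipode y * sg 𝒜 j (H.antipode x) := by
  let q : A →ₗ[K] A := H.antipode ∘ₗ LinearMap.mulRight K y
  let q' : A →ₗ[K] A := LinearMap.mulLeft K (H.antipode y) ∘ₗ (sg 𝒜 j).toLinearMap ∘ₗ H.antipode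
  suffices h : q = q' from LinearMap.congr_fun h x
  apply H.cancel (H.conv_phi_s (sg 𝒜 j))
  have e1 : ∀ t : A ⊗[K] A, LinearMap.mul' K A (TensorProduct.map q (sg 𝒜 j).toLinearMap t)
      = H.V t y := by
    intro t
    induction t with
    | zero => simp
    | add x x' h h' => simp only [map_add, LinearMap.add_apply, h, h']
    | tmul a b =>
      rw [V_tmul]
      simp only [sg_hom 𝒜 _ hy, TensorProduct.map_tmul, LinearMap.mul'_apply,
        AlgHom.toLinearMap_apply, sg_apply 𝒜 j b, Finset.mul_sum, q, LinearMap.comp_apply,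
        LinearMap.mulRight_apply]
      refine Finset.sum_congr rfl fun i _ => ?_
      rw [sgn_comm]; simp
  have e2 : ∀ t : A ⊗[K] A, LinearMap.mul' K A (TensorProduct.map q' (sg 𝒜 j).toLinearMap t)
      = H.antipode y * LinearMap.mul' K A (TensorProduct.map ((sg 𝒜 j).toLinearMap ∘ₗ H.antipode)
        (sg 𝒜 j).toLinearMap t) := by
    intro t
    induction t with
    | zero => simp
    | add x x' h h' => simp only [map_add, mul_add, h, h']
    | tmul a b => simp [q', mul_assoc]
  ext z
  have h3 := LinearMap.congr_fun (H.conv_s_phi (sg 𝒜 j)) z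
  simp only [conv, LinearMap.comp_apply] at h3 ⊢
  rw [e1, e2, h3, V_comul]
  simp only [cone, LinearMap.comp_apply, LinearMap.smul_apply, Algebra.linearMap_apply]
  rw [Algebra.smul_def, Algebra.commutes]

lemma antipode_mul (hcomm : ∀ (i j : ZMod 2) (a b : A), a ∈ 𝒜 i → b ∈ 𝒜 j →
      a * b = ((-1 : K) ^ (i.val * j.val)) • (b * a)) (x y : A) :
    H.antipode (x * y) = H.antipode x * H.antipode y := by
  induction x using hom_ind 𝒜 with
  | hadd x x' hx hx' => simp only [map_add, add_mul, hx, hx']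
  | h i x hx =>
  induction y using hom_ind 𝒜 with
  | hadd x x' hx hx' => simp only [map_add, mul_add, hx, hx']
  | h j y hy =>
  rw [H.antipode_mul_aux x y hy, sg_hom 𝒜 j (H.antipode_graded _ _ hx),
    hcomm _ _ _ _ (H.antipode_graded _ _ hx) (H.antipode_graded _ _ hy)]
  simp

lemma antipode_antipode (hcomm : ∀ (i j : ZMod 2) (a b : A), a ∈ 𝒜 i → b ∈ 𝒜 j →
      a * b = ((-1 : K) ^ (i.val * j.val)) • (b * a)) (x : A) :
    H.antipode (H.antipode x) = x := by
  let S : A →ₐ[K] A := AlgHom.ofLinearMap H.antipode H.antipode_one (H.antipode_mul hcomm)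
  have h := H.conv_s_phi S
  have := H.inv_unique h H.conv_s_id
  exact LinearMap.congr_fun this x

end SuperHopf

variable (I : Submodule K A)

abbrev JL : Submodule K (A ⊗[K] A) :=
  LinearMap.range (TensorProduct.map I.subtype (LinearMap.id : A →ₗ[K] A))
abbrev JR : Submodule K (A ⊗[K] A) :=
  LinearMap.range (TensorProduct.map (LinearMap.id : A →ₗ[K] A) I.subtype)

variable {I}

lemma tmul_mem_JR (a : A) {x : A} (hx : x ∈ I) : a ⊗ₜ[K] x ∈ JR I := ⟨a ⊗ₜ ⟨x, hx⟩, rfl⟩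
lemma tmul_mem_JL (a : A) {x : A} (hx : x ∈ I) : x ⊗ₜ[K] a ∈ JL I := ⟨⟨x, hx⟩ ⊗ₜ a, rfl⟩

lemma JR_le {N : Submodule K (A ⊗[K] A)} (h : ∀ a, ∀ x ∈ I, a ⊗ₜ[K] x ∈ N) : JR I ≤ N := by
  rintro _ ⟨t, rfl⟩
  induction t with
  | zero => simp
  | add x y hx hy => rw [map_add]; exact N.add_mem hx hy
  | tmul a b => exact h a b b.2

lemma JL_le {N : Submodule K (A ⊗[K] A)} (h : ∀ a, ∀ x ∈ I, x ⊗ₜ[K] a ∈ N) : JL I ≤ N := by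
  rintro _ ⟨t, rfl⟩
  induction t with
  | zero => simp
  | add x y hx hy => rw [map_add]; exact N.add_mem hx hy
  | tmul a b => exact h b a a.2

lemma mem_JR_iff (t : A ⊗[K] A) : t ∈ JR I ↔ TensorProduct.map LinearMap.id I.mkQ t = 0 := by
  have h : Function.Exact I.subtype I.mkQ := LinearMap.exact_subtype_mkQ I
  exact ((lTensor_exact A h I.mkQ_surjective) t).symm

lemma JL_ker {t : A ⊗[K] A} (h : t ∈ JL I) : TensorProduct.map I.mkQ LinearMap.id t = 0 := by
  have h2 : JL I ≤ LinearMap.ker (TensorProduct.map I.mkQ (LinearMap.id : A →ₗ[K] A)) := by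
    apply JL_le
    intro a x hx
    have : I.mkQ x = 0 := by simpa using hx
    rw [LinearMap.mem_ker, TensorProduct.map_tmul, this, TensorProduct.zero_tmul]
  exact h2 h

/-- mult as linear maps on the plain tensor product -/
noncomputable def gm : A ⊗[K] A →ₗ[K] A ⊗[K] A →ₗ[K] A ⊗[K] A :=
  ((LinearMap.mul K (CC 𝒜)).compl₁₂ (of K 𝒜 𝒜).toLinearMap (of K 𝒜 𝒜).toLinearMap).compr₂
    (of K 𝒜 𝒜).symm.toLinearMap

lemma gm_apply (x y : A ⊗[K] A) : gm 𝒜 x y = (of K 𝒜 𝒜).symm (of K 𝒜 𝒜 x * of K 𝒜 𝒜 y) := rfl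

lemma gm_tmul (a b c d : A) : gm 𝒜 (a ⊗ₜ b) (c ⊗ₜ d) =
    ∑ j, ∑ i, sgn K j i • ((a * pj 𝒜 i c) ⊗ₜ (pj 𝒜 j b * d)) := by
  rw [gm_apply, gmul]
  simp only [map_sum, map_smul, of_symm_of]

lemma JR_mul_left (hIl : ∀ a : A, ∀ x ∈ I, a * x ∈ I) (c x : A ⊗[K] A) (hx : x ∈ JR I) :
    gm 𝒜 c x ∈ JR I := by
  induction c with
  | zero => simp
  | add c c' h h' => rw [map_add, LinearMap.add_apply]; exact (JR I).add_mem h h'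
  | tmul c d =>
    have h2 : JR I ≤ (JR I).comap (gm 𝒜 (c ⊗ₜ d)) := by
      apply JR_le
      intro a x hx
      rw [Submodule.mem_comap, gm_tmul]
      exact Submodule.sum_mem _ fun j _ => Submodule.sum_mem _ fun i _ =>
        Submodule.smul_mem _ _ (tmul_mem_JR _ (hIl _ _ hx))
    exact h2 hx

lemma JL_mul_left (hIl : ∀ a : A, ∀ x ∈ I, a * x ∈ I)
    (hIhom : ∀ x ∈ I, ∀ i : ZMod 2, GradedAlgebra.proj 𝒜 i x ∈ I)
    (c x : A ⊗[K] A) (hx : x ∈ JL I) :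
    gm 𝒜 c x ∈ JL I := by
  induction c with
  | zero => simp
  | add c c' h h' => rw [map_add, LinearMap.add_apply]; exact (JL I).add_mem h h'
  | tmul c d =>
    have h2 : JL I ≤ (JL I).comap (gm 𝒜 (c ⊗ₜ d)) := by
      apply JL_le
      intro a x hx
      rw [Submodule.mem_comap, gm_tmul]
      exact Submodule.sum_mem _ fun j _ => Submodule.sum_mem _ fun i _ =>
        Submodule.smul_mem _ _ (tmul_mem_JL _ (hIl _ _ (hIhom _ hx _)))
    exact h2 hx

lemma JR_mul_right (hIr : ∀ a : A, ∀ x ∈ I, x * a ∈ I)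
    (hIhom : ∀ x ∈ I, ∀ i : ZMod 2, GradedAlgebra.proj 𝒜 i x ∈ I)
    (c x : A ⊗[K] A) (hx : x ∈ JR I) :
    gm 𝒜 x c ∈ JR I := by
  induction c with
  | zero => simp
  | add c c' h h' => rw [map_add]; exact (JR I).add_mem h h'
  | tmul c d =>
    have h2 : JR I ≤ (JR I).comap ((gm 𝒜).flip (c ⊗ₜ d)) := by
      apply JR_le
      intro a x hx
      rw [Submodule.mem_comap, LinearMap.flip_apply, gm_tmul]
      exact Submodule.sum_mem _ fun j _ => Submodule.sum_mem _ fun i _ =>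
        Submodule.smul_mem _ _ (tmul_mem_JR _ (hIr _ _ (hIhom _ hx _)))
    exact h2 hx

lemma comm_homog {i j : ZMod 2} {a b : A} (ha : a ∈ 𝒜 i) (hb : b ∈ 𝒜 j) :
    GradedTensorProduct.comm 𝒜 𝒜 (of K 𝒜 𝒜 (a ⊗ₜ b)) = sgn K j i • of K 𝒜 𝒜 (b ⊗ₜ a) := by
  have := comm_coe_tmul_coe (R := K) 𝒜 𝒜 ⟨a, ha⟩ ⟨b, hb⟩
  rw [sgn_units (K := K)] at this
  exact this

lemma comm_i1 (a : A) : GradedTensorProduct.comm 𝒜 𝒜 (i1 𝒜 a) = i2 𝒜 a := by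
  change GradedTensorProduct.comm 𝒜 𝒜 (of K 𝒜 𝒜 (a ⊗ₜ 1)) = of K 𝒜 𝒜 (1 ⊗ₜ a)
  induction a using hom_ind 𝒜 with
  | hadd x y hx hy => simp only [TensorProduct.add_tmul, TensorProduct.tmul_add, map_add, hx, hy]
  | h i a ha => rw [comm_homog 𝒜 ha SetLike.GradedOne.one_mem]; simp [sgn]

lemma comm_i2 (a : A) : GradedTensorProduct.comm 𝒜 𝒜 (i2 𝒜 a) = i1 𝒜 a := by
  change GradedTensorProduct.comm 𝒜 𝒜 (of K 𝒜 𝒜 (1 ⊗ₜ a)) = of K 𝒜 𝒜 (a ⊗ₜ 1)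
  induction a using hom_ind 𝒜 with
  | hadd x y hx hy => simp only [TensorProduct.add_tmul, TensorProduct.tmul_add, map_add, hx, hy]
  | h i a ha => rw [comm_homog 𝒜 SetLike.GradedOne.one_mem ha]; simp [sgn]

lemma comm_JL (hIhom : ∀ x ∈ I, ∀ i : ZMod 2, GradedAlgebra.proj 𝒜 i x ∈ I)
    (t : A ⊗[K] A) (ht : t ∈ JL I) :
    (of K 𝒜 𝒜).symm (GradedTensorProduct.comm 𝒜 𝒜 (of K 𝒜 𝒜 t)) ∈ JR I := by
  have h2 : JL I ≤ (JR I).comap ((of K 𝒜 𝒜).symm.toLinearMap ∘ₗ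
      (GradedTensorProduct.comm 𝒜 𝒜).toLinearMap ∘ₗ (of K 𝒜 𝒜).toLinearMap) := by
    apply JL_le
    intro a x hx
    simp only [Submodule.mem_comap, LinearMap.comp_apply, LinearEquiv.coe_coe,
      AlgEquiv.toLinearMap_apply]
    rw [← pj_sum 𝒜 a, ← pj_sum 𝒜 x]
    simp only [TensorProduct.tmul_sum, TensorProduct.sum_tmul, map_sum]
    refine Submodule.sum_mem _ fun j _ => Submodule.sum_mem _ fun i _ => ?_
    rw [comm_homog 𝒜 (pj_mem 𝒜 _ _) (pj_mem 𝒜 _ _), map_smul, of_symm_of]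
    exact Submodule.smul_mem _ _ (tmul_mem_JR _ (hIhom _ hx _))
  exact h2 ht

/-- triple product -/
noncomputable def Th {T : Type} [Ring T] [Algebra K T] (u v w : A →ₗ[K] T) :
    (A ⊗[K] A) ⊗[K] A →ₗ[K] T :=
  LinearMap.mul' K T ∘ₗ TensorProduct.map (LinearMap.mul' K T ∘ₗ TensorProduct.map u v) w

lemma Th_tmul {T : Type} [Ring T] [Algebra K T] (u v w : A →ₗ[K] T) (a b c : A) :
    Th u v w ((a ⊗ₜ b) ⊗ₜ c) = u a * v b * w c := by simp [Th]

lemma hom_span (t : (A ⊗[K] A) ⊗[K] A) :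
    ∃ (n : ℕ) (f₁ f₂ f₃ : Fin n → A) (d e : Fin n → ZMod 2),
      (∀ k, f₁ k ∈ 𝒜 (d k)) ∧ (∀ k, f₂ k ∈ 𝒜 (e k)) ∧
      t = ∑ k, (f₁ k ⊗ₜ[K] f₂ k) ⊗ₜ[K] f₃ k := by
  let S : Set ((A ⊗[K] A) ⊗[K] A) :=
    {x | ∃ (a b c : A) (d e : ZMod 2), a ∈ 𝒜 d ∧ b ∈ 𝒜 e ∧ x = (a ⊗ₜ b) ⊗ₜ c}
  have ht : t ∈ Submodule.span K S := by
    induction t with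
    | zero => simp
    | add x y hx hy => exact Submodule.add_mem _ hx hy
    | tmul x c =>
      induction x with
      | zero => simp
      | add x y hx hy => rw [TensorProduct.add_tmul]; exact Submodule.add_mem _ hx hy
      | tmul a b =>
        rw [← pj_sum 𝒜 a, ← pj_sum 𝒜 b]
        simp only [TensorProduct.tmul_sum, TensorProduct.sum_tmul]
        refine Submodule.sum_mem _ fun j _ => Submodule.sum_mem _ fun i _ => ?_
        exact Submodule.subset_span ⟨_, _, _, _, _, pj_mem 𝒜 _ _, pj_mem 𝒜 _ _, rfl⟩
  obtain ⟨n, f, g, h⟩ := (Submodule.mem_span_set' ).1 ht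
  choose a b c d e ha hb hx using fun k => (g k).2
  refine ⟨n, a, b, fun k => f k • c k, d, e, ha, hb, ?_⟩
  rw [← h]
  refine Finset.sum_congr rfl fun k _ => ?_
  rw [hx k, TensorProduct.tmul_smul]

namespace SuperHopf

variable {𝒜} (H : SuperHopf K A 𝒜)

lemma conv_conv {T : Type} [Ring T] [Algebra K T] (u v w : A →ₗ[K] T) (x : A) :
    H.conv (H.conv u v) w x = Th u v w (TensorProduct.map H.comul LinearMap.id (H.comul x)) := by
  have : ∀ t : A ⊗[K] A, LinearMap.mul' K T (TensorProduct.map (H.conv u v) w t) =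
      Th u v w (TensorProduct.map H.comul LinearMap.id t) := by
    intro t
    induction t with
    | zero => simp
    | add x y hx hy => simp only [map_add, hx, hy]
    | tmul a b => simp [Th, conv]
  exact this _

lemma comp_conv_conv {T T' : Type} [Ring T] [Algebra K T] [Ring T'] [Algebra K T']
    (L : T →ₗ[K] T') (u v w : A →ₗ[K] T)
    (u' v' w' : A →ₗ[K] T') (h : ∀ a b c, L (u a * v b * w c) = u' a * v' b * w' c) (x : A) :
    L (H.conv (H.conv u v) w x) = H.conv (H.conv u' v') w' x := by
  rw [conv_conv, conv_conv]
  have : L ∘ₗ Th u v w = Th u' v' w' := by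
    ext a b c
    simpa [Th] using h a b c
  exact LinearMap.congr_fun this _

noncomputable abbrev e1 (_ : SuperHopf K A 𝒜) : A →ₗ[K] CC 𝒜 := (i1 𝒜).toLinearMap
noncomputable abbrev e2 (_ : SuperHopf K A 𝒜) : A →ₗ[K] CC 𝒜 := (i2 𝒜).toLinearMap

abbrev Normal (I : Submodule K A) : Prop :=
    ∀ f ∈ I, ∀ (n : ℕ) (f₁ f₂ f₃ : Fin n → A) (d e : Fin n → ZMod 2),
      (∀ k, f₁ k ∈ 𝒜 (d k)) → (∀ k, f₂ k ∈ 𝒜 (e k)) →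
      (TensorProduct.assoc K A A A).toLinearMap
          (TensorProduct.map H.comul LinearMap.id (H.comul f))
        = ∑ k : Fin n, f₁ k ⊗ₜ[K] (f₂ k ⊗ₜ[K] f₃ k) →
      (∑ k : Fin n, ((-1 : K) ^ ((d k).val * (e k).val)) •
          (f₂ k ⊗ₜ[K] (f₁ k * H.antipode (f₃ k))))
        ∈ LinearMap.range (TensorProduct.map I.subtype (LinearMap.id : A →ₗ[K] A))

lemma tri_hom {i j : ZMod 2} {a b : A} (c : A) (ha : a ∈ 𝒜 i) (hb : b ∈ 𝒜 j) :
    i2 𝒜 a * i1 𝒜 b * i2 𝒜 c = sgn K i j • of K 𝒜 𝒜 (b ⊗ₜ (a * c)) := by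
  have h1 : i2 𝒜 a * i1 𝒜 b = of K 𝒜 𝒜 (1 ⊗ₜ a) * of K 𝒜 𝒜 (b ⊗ₜ 1) := rfl
  rw [h1, gmul_hom 𝒜 _ _ _ _ ha hb, smul_mul_assoc, mul_one, one_mul, ← i1_mul_i2, mul_assoc,
    ← map_mul, i1_mul_i2]

lemma M_mem (hn : H.Normal I) {f : A} (hf : f ∈ I) :
    (of K 𝒜 𝒜).symm (H.conv (H.conv H.e2 H.e1) (H.e2 ∘ₗ H.antipode) f) ∈ JL I := by
  obtain ⟨n, f₁, f₂, f₃, d, e, h1, h2, h3⟩ :=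
    hom_span 𝒜 (TensorProduct.map H.comul LinearMap.id (H.comul f))
  have := hn f hf n f₁ f₂ f₃ d e h1 h2 (by rw [h3]; simp)
  rw [conv_conv, h3]
  simp only [map_sum, Th_tmul]
  convert this using 2 with k
  simp only [LinearMap.comp_apply, AlgHom.toLinearMap_apply, e1, e2]
  rw [tri_hom _ (h1 k) (h2 k), map_smul, of_symm_of]

/-- `(h, g) ↦ g⁻¹ h g` -/
lemma P_mem (hcomm : ∀ (i j : ZMod 2) (a b : A), a ∈ 𝒜 i → b ∈ 𝒜 j →
      a * b = ((-1 : K) ^ (i.val * j.val)) • (b * a)) (hn : H.Normal I) {f : A} (hf : f ∈ I) :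
    (of K 𝒜 𝒜).symm (H.conv (H.conv (H.e2 ∘ₗ H.antipode) H.e1) H.e2 f) ∈ JL I := by
  let L : CC 𝒜 →ₗ[K] CC 𝒜 := (of K 𝒜 𝒜).toLinearMap ∘ₗ
    TensorProduct.map LinearMap.id H.antipode ∘ₗ (of K 𝒜 𝒜).symm.toLinearMap
  have hL : ∀ a b, L (of K 𝒜 𝒜 (a ⊗ₜ b)) = of K 𝒜 𝒜 (a ⊗ₜ H.antipode b) := fun a b => rfl
  rw [← H.comp_conv_conv L H.e2 H.e1 (H.e2 ∘ₗ H.antipode)]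
  · have h2 : JL I ≤ (JL I).comap (TensorProduct.map LinearMap.id H.antipode) := by
      apply JL_le
      intro a x hx
      exact tmul_mem_JL _ hx
    exact h2 (H.M_mem hn hf)
  · intro a b c
    simp only [LinearMap.comp_apply, AlgHom.toLinearMap_apply, e1, e2]
    rw [tri_form, tri_form]
    simp only [map_sum, map_smul, hL, H.antipode_mul hcomm, H.antipode_antipode hcomm, antipode_pj]

/-- `(g, h) ↦ g h⁻¹ g⁻¹` -/
lemma N_mem (hIhom : ∀ x ∈ I, ∀ i : ZMod 2, GradedAlgebra.proj 𝒜 i x ∈ I)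
    (hIantipode : ∀ x ∈ I, H.antipode x ∈ I) (hn : H.Normal I) {f : A} (hf : f ∈ I) :
    (of K 𝒜 𝒜).symm
      (H.conv (H.conv H.e1 (H.e2 ∘ₗ H.antipode)) (H.e1 ∘ₗ H.antipode) f) ∈ JR I := by
  let L : CC 𝒜 →ₗ[K] CC 𝒜 := (of K 𝒜 𝒜).toLinearMap ∘ₗ
    TensorProduct.map H.antipode LinearMap.id ∘ₗ (of K 𝒜 𝒜).symm.toLinearMap
  have hL : ∀ a b, L (of K 𝒜 𝒜 (a ⊗ₜ b)) = of K 𝒜 𝒜 (H.antipode a ⊗ₜ b) := fun a b => rfl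
  rw [← H.comp_conv_conv ((GradedTensorProduct.comm 𝒜 𝒜).toLinearMap ∘ₗ L)
    H.e2 H.e1 (H.e2 ∘ₗ H.antipode)]
  · have h2 : JL I ≤ (JL I).comap (TensorProduct.map H.antipode LinearMap.id) := by
      apply JL_le
      intro a x hx
      exact tmul_mem_JL _ (hIantipode _ hx)
    exact comm_JL 𝒜 hIhom _ (h2 (H.M_mem hn hf))
  · intro a b c
    simp only [LinearMap.comp_apply, AlgHom.toLinearMap_apply, e1, e2, AlgEquiv.toLinearMap_apply]
    have : L (i2 𝒜 a * i1 𝒜 b * i2 𝒜 (H.antipode c)) =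
        i2 𝒜 a * i1 𝒜 (H.antipode b) * i2 𝒜 (H.antipode c) := by
      rw [tri_form, tri_form]
      simp only [map_sum, map_smul, hL, antipode_pj]
    rw [this, map_mul, map_mul, comm_i1, comm_i2, comm_i2]

lemma conv_e1_e2 (x : A) : H.conv H.e1 H.e2 x = of K 𝒜 𝒜 (H.comul x) := by
  have : ∀ t : A ⊗[K] A, LinearMap.mul' K (CC 𝒜) (TensorProduct.map H.e1 H.e2 t) =
      of K 𝒜 𝒜 t := by
    intro t
    induction t with
    | zero => simp
    | add x y hx hy => simp only [map_add, hx, hy]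
    | tmul a b => exact i1_mul_i2 𝒜 a b
  exact this _

lemma comul_antipode (x : A) : of K 𝒜 𝒜 (H.comul (H.antipode x)) =
    H.conv (H.e2 ∘ₗ H.antipode) (H.e1 ∘ₗ H.antipode) x := by
  let D : A →ₐ[K] CC 𝒜 := AlgHom.ofLinearMap ((of K 𝒜 𝒜).toLinearMap ∘ₗ H.comul)
    (by simp only [LinearMap.comp_apply, H.comul_one]; rfl) (H.comul_mul')
  have hD : D.toLinearMap = H.conv H.e1 H.e2 := by
    ext x; rw [conv_e1_e2]; rfl
  have h1 := H.conv_s_phi D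
  have h2 : H.conv D.toLinearMap (H.conv (H.e2 ∘ₗ H.antipode) (H.e1 ∘ₗ H.antipode)) =
      H.cone (CC 𝒜) := by
    rw [hD, conv_assoc, ← H.conv_assoc H.e2, H.conv_phi_s (i2 𝒜), cone_conv,
      H.conv_phi_s (i1 𝒜)]
  exact LinearMap.congr_fun (H.inv_unique h1 h2) x

lemma comul_antipode' (x : A) : of K 𝒜 𝒜 (H.comul (H.antipode x)) =
    H.conv (H.e1 ∘ₗ H.antipode)
      (H.conv (H.conv H.e1 (H.e2 ∘ₗ H.antipode)) (H.e1 ∘ₗ H.antipode)) x := by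
  rw [comul_antipode, conv_assoc H H.e1, ← conv_assoc H _ H.e1, H.conv_s_phi (i1 𝒜), cone_conv]

lemma comul_P (x : A) : of K 𝒜 𝒜 (H.comul x) =
    H.conv H.e2 (H.conv (H.conv (H.e2 ∘ₗ H.antipode) H.e1) H.e2) x := by
  rw [conv_assoc H _ H.e1, ← conv_assoc H H.e2 (H.e2 ∘ₗ H.antipode), H.conv_phi_s (i2 𝒜),
    cone_conv, conv_e1_e2]

lemma P_one : H.conv (H.conv (H.e2 ∘ₗ H.antipode) H.e1) H.e2 1 = 1 := by
  rw [conv_conv, H.comul_one, TensorProduct.map_tmul, H.comul_one, LinearMap.id_apply, Th_tmul]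
  simp only [LinearMap.comp_apply, antipode_one, AlgHom.toLinearMap_apply, map_one, mul_one]

lemma N_one : H.conv (H.conv H.e1 (H.e2 ∘ₗ H.antipode)) (H.e1 ∘ₗ H.antipode) 1 = 1 := by
  rw [conv_conv, H.comul_one, TensorProduct.map_tmul, H.comul_one, LinearMap.id_apply, Th_tmul]
  simp only [LinearMap.comp_apply, antipode_one, AlgHom.toLinearMap_apply, map_one, mul_one]

end SuperHopf

namespace SuperHopf

variable {𝒜} (H : SuperHopf K A 𝒜)

/-- invariance -/
def Inv (I : Submodule K A) (f : A) : Prop := H.comul f - f ⊗ₜ 1 ∈ JR I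

lemma mem_ker_iff (f : A) : f ∈ LinearMap.ker
        ((TensorProduct.map LinearMap.id I.mkQ ∘ₗ H.comul) -
          (TensorProduct.mk K A (A ⧸ I)).flip (I.mkQ 1)) ↔ H.Inv I f := by
  rw [Inv, mem_JR_iff, LinearMap.mem_ker, map_sub]
  rfl

lemma inv_mul (hIl : ∀ a : A, ∀ x ∈ I, a * x ∈ I) (hIr : ∀ a : A, ∀ x ∈ I, x * a ∈ I)
    (hIhom : ∀ x ∈ I, ∀ i : ZMod 2, GradedAlgebra.proj 𝒜 i x ∈ I) {f g : A}
    (hf : H.Inv I f) (hg : H.Inv I g) : H.Inv I (f * g) := by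
  have h1 := JR_mul_right 𝒜 hIr hIhom (H.comul g) _ hf
  have h2 := JR_mul_left 𝒜 hIl (f ⊗ₜ 1) _ hg
  have h3 : gm 𝒜 (H.comul f) (H.comul g) = H.comul (f * g) := by
    rw [gm_apply, ← comul_mul', of_symm_of]
  have h4 : gm 𝒜 (f ⊗ₜ 1) (g ⊗ₜ 1) = (f * g) ⊗ₜ 1 := by
    rw [gm_apply]
    change (of K 𝒜 𝒜).symm (i1 𝒜 f * i1 𝒜 g) = _
    rw [← map_mul]; rfl
  have := (JR I).add_mem h1 h2
  rw [map_sub, map_sub, LinearMap.sub_apply, h3, h4, sub_add_sub_cancel] at this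
  exact this

lemma comul_sg (j : ZMod 2) (x : A) : H.comul (sg 𝒜 j x) =
    TensorProduct.map (sg 𝒜 j).toLinearMap (sg 𝒜 j).toLinearMap (H.comul x) := by
  induction x using hom_ind 𝒜 with
  | hadd x y hx hy => simp only [map_add, hx, hy]
  | h i x hx =>
    rw [sg_hom 𝒜 j hx, map_smul]
    have h := H.comul_graded i x hx
    have hle : (⨆ k : ZMod 2, LinearMap.range
        (TensorProduct.map ((𝒜 k).subtype) ((𝒜 (i - k)).subtype))) ≤
        LinearMap.ker (TensorProduct.map (sg 𝒜 j).toLinearMap (sg 𝒜 j).toLinearMap -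
          sgn K i j • LinearMap.id) := by
      refine iSup_le fun k => ?_
      rintro _ ⟨t, rfl⟩
      induction t with
      | zero => simp
      | add x y hx hy => rw [map_add]; exact Submodule.add_mem _ hx hy
      | tmul a b =>
        have := sgn_add (K := K) k (i - k) j
        rw [add_sub_cancel] at this
        rw [LinearMap.mem_ker, LinearMap.sub_apply, this]
        simp only [TensorProduct.map_tmul, Submodule.subtype_apply, AlgHom.toLinearMap_apply,
          sg_hom 𝒜 j a.2, sg_hom 𝒜 j b.2, LinearMap.smul_apply, LinearMap.id_apply,
          TensorProduct.smul_tmul_smul, sub_self]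
    have := hle h
    rw [LinearMap.mem_ker, LinearMap.sub_apply, sub_eq_zero] at this
    exact this.symm

lemma inv_sg (hIhom : ∀ x ∈ I, ∀ i : ZMod 2, GradedAlgebra.proj 𝒜 i x ∈ I) (j : ZMod 2) {f : A}
    (hf : H.Inv I f) : H.Inv I (sg 𝒜 j f) := by
  have hle : JR I ≤ (JR I).comap
      (TensorProduct.map (sg 𝒜 j).toLinearMap (sg 𝒜 j).toLinearMap) := by
    apply JR_le
    intro a x hx
    apply tmul_mem_JR
    rw [AlgHom.toLinearMap_apply, sg_apply]
    exact Submodule.sum_mem _ fun i _ => Submodule.smul_mem _ _ (hIhom _ hx _)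
  have := hle hf
  rw [Submodule.mem_comap, map_sub, ← comul_sg, TensorProduct.map_tmul,
    AlgHom.toLinearMap_apply, AlgHom.toLinearMap_apply, map_one] at this
  exact this

lemma pj_eq (hK : (2 : K) ≠ 0) (i : ZMod 2) (f : A) :
    pj 𝒜 i f = (2 : K)⁻¹ • (f + sgn K i 1 • sg 𝒜 1 f) := by
  have h : ∀ i : ZMod 2, i = 0 ∨ i = 1 := by decide
  have h1 : (1 : ZMod 2).val = 1 := rfl
  rw [eq_inv_smul_iff₀ hK, two_smul]
  have hs := pj_sum 𝒜 f
  have hs' := sg_apply 𝒜 1 f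
  rw [show (Finset.univ : Finset (ZMod 2)) = {0, 1} from rfl,
    Finset.sum_pair (by decide)] at hs hs'
  rw [hs']
  nth_rw 3 [← hs]
  rcases h i with rfl | rfl <;> simp [sgn, h1] <;> abel

lemma inv_antipode (hIl : ∀ a : A, ∀ x ∈ I, a * x ∈ I)
    (hIhom : ∀ x ∈ I, ∀ i : ZMod 2, GradedAlgebra.proj 𝒜 i x ∈ I)
    (hIantipode : ∀ x ∈ I, H.antipode x ∈ I) (hn : H.Normal I) {f : A}
    (hf : H.Inv I f) : H.Inv I (H.antipode f) := by
  let N := H.conv (H.conv H.e1 (H.e2 ∘ₗ H.antipode)) (H.e1 ∘ₗ H.antipode)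
  let B : A ⊗[K] A →ₗ[K] A ⊗[K] A := (of K 𝒜 𝒜).symm.toLinearMap ∘ₗ
    LinearMap.mul' K (CC 𝒜) ∘ₗ TensorProduct.map (H.e1 ∘ₗ H.antipode) N
  have hle : JR I ≤ (JR I).comap B := by
    apply JR_le
    intro a x hx
    exact JR_mul_left 𝒜 hIl (H.antipode a ⊗ₜ 1) _ (H.N_mem hIhom hIantipode hn hx)
  have h1 : B (H.comul f) = H.comul (H.antipode f) := by
    apply (of K 𝒜 𝒜).injective
    rw [comul_antipode']; rfl
  have h2 : B (f ⊗ₜ 1) = H.antipode f ⊗ₜ 1 := by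
    change (of K 𝒜 𝒜).symm (i1 𝒜 (H.antipode f) * N 1) = _
    rw [show N 1 = 1 from H.N_one, mul_one]; rfl
  have := hle hf
  rw [Submodule.mem_comap, map_sub, h1, h2] at this
  exact this

/-- the map defining invariants -/
noncomputable def phi (I : Submodule K A) : A →ₗ[K] A ⊗[K] (A ⧸ I) :=
  ((TensorProduct.map LinearMap.id I.mkQ ∘ₗ H.comul) -
          (TensorProduct.mk K A (A ⧸ I)).flip (I.mkQ 1))

lemma phi_right {f : A} (hf : H.Inv I f) :
    TensorProduct.map LinearMap.id (H.phi I) (H.comul f) = 0 := by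
  have hf' : TensorProduct.map LinearMap.id I.mkQ (H.comul f) = f ⊗ₜ I.mkQ 1 := by
    have := (mem_JR_iff _).1 hf
    rw [map_sub, sub_eq_zero] at this
    exact this
  have key : ∀ t : A ⊗[K] A, TensorProduct.map LinearMap.id (H.phi I) t =
      TensorProduct.map LinearMap.id (TensorProduct.map LinearMap.id I.mkQ)
        (TensorProduct.map LinearMap.id H.comul t) -
      TensorProduct.assoc K A A (A ⧸ I) (t ⊗ₜ I.mkQ 1) := by
    intro t
    induction t with
    | zero => simp
    | add x y hx hy => simp only [map_add, TensorProduct.add_tmul, hx, hy]; abel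
    | tmul a b => simp [phi, TensorProduct.tmul_sub]
  have h2 : ∀ t : (A ⊗[K] A) ⊗[K] A,
      TensorProduct.map LinearMap.id (TensorProduct.map LinearMap.id I.mkQ)
        (TensorProduct.assoc K A A A t) =
      TensorProduct.assoc K A A (A ⧸ I) (TensorProduct.map LinearMap.id I.mkQ t) := by
    intro t
    have : TensorProduct.map LinearMap.id (TensorProduct.map LinearMap.id I.mkQ) ∘ₗ
        (TensorProduct.assoc K A A A).toLinearMap =
      (TensorProduct.assoc K A A (A ⧸ I)).toLinearMap ∘ₗ TensorProduct.map LinearMap.id I.mkQ := by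
      ext; rfl
    exact LinearMap.congr_fun this t
  have h3 := LinearMap.congr_fun H.coassoc f
  simp only [LinearMap.comp_apply, LinearEquiv.coe_coe] at h3
  have h4 : TensorProduct.map LinearMap.id I.mkQ (TensorProduct.map H.comul LinearMap.id
      (H.comul f)) = TensorProduct.map H.comul LinearMap.id
        (TensorProduct.map LinearMap.id I.mkQ (H.comul f)) := by
    generalize H.comul f = t
    induction t with
    | zero => simp
    | add x y hx hy => simp only [map_add, hx, hy]
    | tmul a b => rfl
  rw [key, ← h3, h2, h4, hf', TensorProduct.map_tmul, LinearMap.id_apply, sub_self]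

lemma phi_left (hcomm : ∀ (i j : ZMod 2) (a b : A), a ∈ 𝒜 i → b ∈ 𝒜 j →
      a * b = ((-1 : K) ^ (i.val * j.val)) • (b * a))
    (hIl : ∀ a : A, ∀ x ∈ I, a * x ∈ I)
    (hIhom : ∀ x ∈ I, ∀ i : ZMod 2, GradedAlgebra.proj 𝒜 i x ∈ I)
    (hn : H.Normal I) {f : A} (hf : H.Inv I f) :
    TensorProduct.map (H.phi I) LinearMap.id (H.comul f) = 0 := by
  let P := H.conv (H.conv (H.e2 ∘ₗ H.antipode) H.e1) H.e2
  let B : A ⊗[K] A →ₗ[K] (A ⧸ I) ⊗[K] A := TensorProduct.map I.mkQ LinearMap.id ∘ₗ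
    (of K 𝒜 𝒜).symm.toLinearMap ∘ₗ
    LinearMap.mul' K (CC 𝒜) ∘ₗ TensorProduct.map H.e2 P
  have hB : ∀ x, B (H.comul x) = TensorProduct.map I.mkQ LinearMap.id (H.comul x) := by
    intro x
    have := congrArg (of K 𝒜 𝒜).symm (H.comul_P x)
    rw [of_symm_of] at this
    exact congrArg (TensorProduct.map I.mkQ LinearMap.id) this.symm
  let G : (A ⊗[K] A) ⊗[K] A →ₗ[K] A ⊗[K] ((A ⧸ I) ⊗[K] A) :=
    TensorProduct.map LinearMap.id B ∘ₗ (TensorProduct.assoc K A A A).toLinearMap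
  let E : A ⊗[K] A →ₗ[K] A ⊗[K] ((A ⧸ I) ⊗[K] A) :=
    TensorProduct.map LinearMap.id (TensorProduct.mk K (A ⧸ I) A (I.mkQ 1))
  have hG1 : ∀ t, G (t ⊗ₜ 1) = E t := by
    intro t
    induction t with
    | zero => simp
    | add x y hx hy => rw [TensorProduct.add_tmul, map_add, map_add, hx, hy]
    | tmul a b =>
      change a ⊗ₜ[K] (TensorProduct.map I.mkQ LinearMap.id
        ((of K 𝒜 𝒜).symm (i2 𝒜 b * P 1))) = a ⊗ₜ[K] (I.mkQ 1 ⊗ₜ[K] b)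
      rw [show P 1 = 1 from H.P_one, mul_one]; rfl
  have hG2 : ∀ t, ∀ x ∈ I, G (t ⊗ₜ x) = 0 := by
    intro t x hx
    induction t with
    | zero => simp
    | add x y hx hy => rw [TensorProduct.add_tmul, map_add, hx, hy, add_zero]
    | tmul a b =>
      change a ⊗ₜ[K] (TensorProduct.map I.mkQ LinearMap.id
        (gm 𝒜 (1 ⊗ₜ b) ((of K 𝒜 𝒜).symm (P x)))) = 0
      rw [JL_ker (JL_mul_left 𝒜 hIl hIhom _ _ (H.P_mem hcomm hn hx)), TensorProduct.tmul_zero]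
  have hG3 : JR I ≤ LinearMap.ker (G ∘ₗ TensorProduct.map H.comul LinearMap.id) := by
    apply JR_le
    intro a x hx
    exact hG2 _ x hx
  have hG4 : G (TensorProduct.map H.comul LinearMap.id (H.comul f)) = E (H.comul f) := by
    have := hG3 hf
    rw [LinearMap.mem_ker, map_sub, sub_eq_zero] at this
    rw [← hG1]; exact this
  have h3 := LinearMap.congr_fun H.coassoc f
  simp only [LinearMap.comp_apply, LinearEquiv.coe_coe] at h3
  have hG5 : TensorProduct.map LinearMap.id (TensorProduct.map I.mkQ LinearMap.id)
      (TensorProduct.assoc K A A A (TensorProduct.map H.comul LinearMap.id (H.comul f)))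
      = E (H.comul f) := by
    rw [← hG4]
    change _ = TensorProduct.map LinearMap.id B (TensorProduct.assoc K A A A _)
    rw [h3]
    generalize H.comul f = t
    induction t with
    | zero => simp
    | add x y hx hy => simp only [map_add, hx, hy]
    | tmul a b => simp only [TensorProduct.map_tmul, hB]
  apply (TensorProduct.assoc K A (A ⧸ I) A).injective
  rw [map_zero]
  have key : ∀ t : A ⊗[K] A,
      TensorProduct.assoc K A (A ⧸ I) A (TensorProduct.map (H.phi I) LinearMap.id t) =
      TensorProduct.map LinearMap.id (TensorProduct.map I.mkQ LinearMap.id)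
      (TensorProduct.assoc K A A A (TensorProduct.map H.comul LinearMap.id t)) - E t := by
    have h2 : ∀ t : (A ⊗[K] A) ⊗[K] A,
      TensorProduct.map LinearMap.id (TensorProduct.map I.mkQ LinearMap.id)
        (TensorProduct.assoc K A A A t) =
      TensorProduct.assoc K A (A ⧸ I) A
        (TensorProduct.map (TensorProduct.map LinearMap.id I.mkQ) LinearMap.id t) := by
      intro t
      have : TensorProduct.map LinearMap.id (TensorProduct.map I.mkQ LinearMap.id) ∘ₗ
          (TensorProduct.assoc K A A A).toLinearMap =
        (TensorProduct.assoc K A (A ⧸ I) A).toLinearMap ∘ₗ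
          TensorProduct.map (TensorProduct.map LinearMap.id I.mkQ) LinearMap.id := by
        ext; rfl
      exact LinearMap.congr_fun this t
    intro t
    rw [h2]
    induction t with
    | zero => simp
    | add x y hx hy => simp only [map_add, hx, hy]; abel
    | tmul a b => simp [phi, TensorProduct.sub_tmul, E]
  rw [key, hG5, sub_self]

end SuperHopf

lemma mem_range_of_ker {W : Type} [AddCommGroup W] [Module K W] (φ : A →ₗ[K] W)
    (R : Submodule K A) (hR : R = LinearMap.ker φ) (t : A ⊗[K] A)
    (h1 : TensorProduct.map φ LinearMap.id t = 0) (h2 : TensorProduct.map LinearMap.id φ t = 0) :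
    t ∈ LinearMap.range (TensorProduct.map R.subtype R.subtype) := by
  subst hR
  have ex : Function.Exact (LinearMap.ker φ).subtype φ := LinearMap.exact_subtype_ker_map φ
  obtain ⟨y, rfl⟩ := (Module.Flat.rTensor_exact A ex t).1 h1
  have inj := Module.Flat.rTensor_preserves_injective_linearMap (M := W)
    (LinearMap.ker φ).subtype (Submodule.injective_subtype _)
  have h3 : LinearMap.lTensor (LinearMap.ker φ) φ y = 0 := by
    apply inj
    rw [map_zero, ← h2]
    change (LinearMap.rTensor W _ ∘ₗ LinearMap.lTensor _ φ) y =
      (LinearMap.lTensor A φ ∘ₗ LinearMap.rTensor A _) y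
    rw [LinearMap.rTensor_comp_lTensor, LinearMap.lTensor_comp_rTensor]
  obtain ⟨z, rfl⟩ := (Module.Flat.lTensor_exact (LinearMap.ker φ) ex y).1 h3
  refine ⟨z, ?_⟩
  rw [← LinearMap.comp_apply, LinearMap.rTensor_comp_lTensor]

end Helpers

/-- if H is a normal closed supersubgroup of an affine supergroup G (with
Hopf superideal I = I_H satisfying the right normality condition
ν_r(f) = Σ (-1)^{|f₁||f₂|} f₂ ⊗ f₁ s(f₃) ∈ I ⊗ K[G] for f ∈ I), then the invariants
R = K[G]^H = {f : Σ f₁ ⊗ p(f₂) = f ⊗ p(1)} form a Hopf supersubalgebra of K[G]; in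
particular R is antipode-stable. -/
theorem invariants_of_normal_supersubgroup_hopf_supersubalgebra
    {K A : Type} [Field K] (hK : (2 : K) ≠ 0)
    [Ring A] [Algebra K A] (𝒜 : ZMod 2 → Submodule K A) [GradedAlgebra 𝒜]
    (hcomm : ∀ (i j : ZMod 2) (a b : A), a ∈ 𝒜 i → b ∈ 𝒜 j →
      a * b = ((-1 : K) ^ (i.val * j.val)) • (b * a))
    (H : SuperHopf K A 𝒜)
    (I : Submodule K A)
    (hIl : ∀ a : A, ∀ x ∈ I, a * x ∈ I) (hIr : ∀ a : A, ∀ x ∈ I, x * a ∈ I)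
    (hIhom : ∀ x ∈ I, ∀ i : ZMod 2, GradedAlgebra.proj 𝒜 i x ∈ I)
    (hIcounit : ∀ x ∈ I, H.counit x = 0)
    (hIantipode : ∀ x ∈ I, H.antipode x ∈ I)
    (hIcomul : ∀ x ∈ I, H.comul x ∈
      LinearMap.range (TensorProduct.map I.subtype (LinearMap.id : A →ₗ[K] A)) ⊔
      LinearMap.range (TensorProduct.map (LinearMap.id : A →ₗ[K] A) I.subtype))
    (hnormal : ∀ f ∈ I, ∀ (n : ℕ) (f₁ f₂ f₃ : Fin n → A) (d e : Fin n → ZMod 2),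
      (∀ k, f₁ k ∈ 𝒜 (d k)) → (∀ k, f₂ k ∈ 𝒜 (e k)) →
      (TensorProduct.assoc K A A A).toLinearMap
          (TensorProduct.map H.comul LinearMap.id (H.comul f))
        = ∑ k : Fin n, f₁ k ⊗ₜ[K] (f₂ k ⊗ₜ[K] f₃ k) →
      (∑ k : Fin n, ((-1 : K) ^ ((d k).val * (e k).val)) •
          (f₂ k ⊗ₜ[K] (f₁ k * H.antipode (f₃ k))))
        ∈ LinearMap.range (TensorProduct.map I.subtype (LinearMap.id : A →ₗ[K] A))) :
    ∀ R : Submodule K A,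
      R = LinearMap.ker
        ((TensorProduct.map LinearMap.id I.mkQ ∘ₗ H.comul) -
          (TensorProduct.mk K A (A ⧸ I)).flip (I.mkQ 1)) →
      (1 : A) ∈ R ∧
      (∀ f ∈ R, ∀ g ∈ R, f * g ∈ R) ∧
      (∀ f ∈ R, ∀ i : ZMod 2, GradedAlgebra.proj 𝒜 i f ∈ R) ∧
      (∀ f ∈ R, H.antipode f ∈ R) ∧
      (∀ f ∈ R, H.comul f ∈
        LinearMap.range (TensorProduct.map R.subtype R.subtype)) := by
  intro R hR
  have hm : ∀ f, f ∈ R ↔ H.Inv I f := by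
    intro f; rw [hR]; exact H.mem_ker_iff f
  refine ⟨?_, ?_, ?_, ?_, ?_⟩
  · rw [hm, SuperHopf.Inv, H.comul_one, sub_self]; exact Submodule.zero_mem _
  · intro f hf g hg
    rw [hm] at *
    exact H.inv_mul hIl hIr hIhom hf hg
  · intro f hf i
    have : GradedAlgebra.proj 𝒜 i f = _ := SuperHopf.pj_eq (𝒜 := 𝒜) hK i f
    rw [this]
    exact R.smul_mem _ (R.add_mem hf (R.smul_mem _
      ((hm _).2 (H.inv_sg hIhom 1 ((hm _).1 hf)))))
  · intro f hf
    rw [hm] at *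
    exact H.inv_antipode hIl hIhom hIantipode hnormal hf
  · intro f hf
    rw [hm] at hf
    exact mem_range_of_ker (H.phi I) R hR _ (H.phi_left hcomm hIl hIhom hnormal hf)
      (H.phi_right hf)
end

section
/- Let A be a supercommutative Hopf superalgebra, B ⊆ A a left coideal supersubalgebra (δ(B) ⊆ A ⊗ B), N a right A-supermodule, and M a left B-supermodule which is also a right A-supercomodule satisfying the compatibility τ_M(bm) = Σ (-1)^{|b₂||a₁|} b₁a₁ ⊗ b₂m₂. Then the map ξ(n ⊗ m) = Σ na₁ ⊗ m₂ (where τ_M(m) = Σ a₁ ⊗ m₂) induces an isomorphism of super vector spaces N ⊗_B M ≅ N ⊗ (M/B⁺M), where B⁺ = B ∩ ker ε. -/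
open TensorProduct

section helpers
variable {K A N X M : Type} [Field K] [Ring A] [Algebra K A] [AddCommGroup N] [Module K N]
  [AddCommGroup X] [Module K X] [AddCommGroup M] [Module K M]

noncomputable def PPx (X : Type) [AddCommGroup X] [Module K X]
    (r : N →ₗ[K] A →ₗ[K] N) (f : A →ₗ[K] A) :
    N →ₗ[K] (A ⊗[K] X →ₗ[K] N ⊗[K] X) :=
  LinearMap.rTensorHom X ∘ₗ (LinearMap.lcomp K N f) ∘ₗ r

theorem PPx_tmul (r : N →ₗ[K] A →ₗ[K] N) (f : A →ₗ[K] A) (n : N) (a : A) (x : X) :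
    PPx X r f n (a ⊗ₜ x) = r n (f a) ⊗ₜ x := rfl

noncomputable def EEx (r : N →ₗ[K] A →ₗ[K] N) (f : A →ₗ[K] A) (τ : X →ₗ[K] A ⊗[K] X) :
    N ⊗[K] X →ₗ[K] N ⊗[K] X :=
  TensorProduct.lift ((LinearMap.lcomp K _ τ) ∘ₗ PPx X r f)

theorem EEx_tmul (r : N →ₗ[K] A →ₗ[K] N) (f : A →ₗ[K] A) (τ : X →ₗ[K] A ⊗[K] X) (n : N) (x : X) :
    EEx r f τ (n ⊗ₜ x) = PPx X r f n (τ x) := rfl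

theorem EEx_comp (r : N →ₗ[K] A →ₗ[K] N) (hr : ∀ n a b, r (r n a) b = r n (a * b))
    (δ : A →ₗ[K] A ⊗[K] A) (τ : X →ₗ[K] A ⊗[K] X)
    (hco : TensorProduct.map LinearMap.id τ ∘ₗ τ
      = (TensorProduct.assoc K A A X).toLinearMap ∘ₗ TensorProduct.map δ LinearMap.id ∘ₗ τ)
    (f g : A →ₗ[K] A) :
    EEx r g τ ∘ₗ EEx r f τ = EEx r (LinearMap.mul' K A ∘ₗ TensorProduct.map f g ∘ₗ δ) τ := by
  apply TensorProduct.ext'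
  intro n x
  rw [LinearMap.comp_apply, EEx_tmul, EEx_tmul]
  set Q : A ⊗[K] (A ⊗[K] X) →ₗ[K] N ⊗[K] X := TensorProduct.lift (PPx X r g ∘ₗ r n ∘ₗ f) with hQ
  have h1 : ∀ z, EEx r g τ (PPx X r f n z) = Q (TensorProduct.map LinearMap.id τ z) := by
    intro z
    induction z with
    | zero => simp
    | add x y hx hy => simp only [map_add, hx, hy]
    | tmul a x => rw [PPx_tmul, EEx_tmul]; simp [hQ]
  have h2 : ∀ z, Q (TensorProduct.assoc K A A X (TensorProduct.map δ LinearMap.id z))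
      = PPx X r (LinearMap.mul' K A ∘ₗ TensorProduct.map f g ∘ₗ δ) n z := by
    intro z
    induction z with
    | zero => simp
    | add x y hx hy => simp only [map_add, hx, hy]
    | tmul a x =>
      rw [PPx_tmul, TensorProduct.map_tmul]
      simp only [LinearMap.comp_apply, LinearMap.id_apply]
      generalize δ a = w
      induction w with
      | zero => simp
      | add x y hx hy => simp only [map_add, TensorProduct.add_tmul, hx, hy]
      | tmul a b => simp [hQ, PPx_tmul, hr]
  rw [h1, ← h2]
  exact congrArg Q (LinearMap.congr_fun hco x)

theorem EEx_unit (r : N →ₗ[K] A →ₗ[K] N) (hr1 : ∀ n, r n 1 = n)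
    (ε : A →ₗ[K] K) (τ : X →ₗ[K] A ⊗[K] X)
    (hc : (TensorProduct.lid K X).toLinearMap ∘ₗ TensorProduct.map ε LinearMap.id ∘ₗ τ
      = LinearMap.id) :
    EEx r (Algebra.linearMap K A ∘ₗ ε) τ = LinearMap.id := by
  apply TensorProduct.ext'
  intro n x
  rw [EEx_tmul]
  have h : ∀ z, PPx X r (Algebra.linearMap K A ∘ₗ ε) n z
      = n ⊗ₜ (TensorProduct.lid K X (TensorProduct.map ε LinearMap.id z)) := by
    intro z
    induction z with
    | zero => simp
    | add x y hx hy => simp only [map_add, hx, hy, TensorProduct.tmul_add]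
    | tmul a x =>
      rw [PPx_tmul]
      simp [Algebra.algebraMap_eq_smul_one, hr1, TensorProduct.smul_tmul]
  rw [h]
  exact congrArg (fun y => n ⊗ₜ[K] y) (LinearMap.congr_fun hc x)

noncomputable def EEequiv (r : N →ₗ[K] A →ₗ[K] N) (hr : ∀ n a b, r (r n a) b = r n (a * b))
    (hr1 : ∀ n, r n 1 = n) (𝒜 : ZMod 2 → Submodule K A) [GradedAlgebra 𝒜] (H : SuperHopf K A 𝒜)
    (τ : X →ₗ[K] A ⊗[K] X)
    (hc : (TensorProduct.lid K X).toLinearMap ∘ₗ TensorProduct.map H.counit LinearMap.id ∘ₗ τ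
      = LinearMap.id)
    (hco : TensorProduct.map LinearMap.id τ ∘ₗ τ
      = (TensorProduct.assoc K A A X).toLinearMap ∘ₗ TensorProduct.map H.comul LinearMap.id ∘ₗ τ) :
    N ⊗[K] X ≃ₗ[K] N ⊗[K] X :=
  LinearEquiv.ofLinearMap (EEx r LinearMap.id τ) (EEx r H.antipode τ)
    (by rw [EEx_comp r hr H.comul τ hco, H.antipode_left, EEx_unit r hr1 _ _ hc])
    (by rw [EEx_comp r hr H.comul τ hco, H.antipode_right, EEx_unit r hr1 _ _ hc])

/-! signs -/
theorem sgn_add_s16 (i j k : ZMod 2) : (-1 : K) ^ (i.val * (j + k).val)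
    = (-1 : K) ^ (i.val * j.val) * (-1 : K) ^ (i.val * k.val) := by
  rw [← pow_add, neg_one_pow_eq_pow_mod_two, neg_one_pow_eq_pow_mod_two (_ + _)]
  congr 1
  revert i j k; decide

theorem sgn_comm_s16 (i j : ZMod 2) : (-1 : K) ^ (i.val * j.val) = (-1 : K) ^ (j.val * i.val) := by
  rw [mul_comm]

theorem sgn_sq (i j : ZMod 2) : (-1 : K) ^ (i.val * j.val) * (-1 : K) ^ (i.val * j.val) = 1 := by
  rw [← mul_pow]; simp

/-! projections -/
noncomputable def prj (𝒩 : ZMod 2 → Submodule K N) [DirectSum.Decomposition 𝒩] (i : ZMod 2) :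
    N →ₗ[K] N :=
  (𝒩 i).subtype ∘ₗ DirectSum.component K (ZMod 2) (fun i => 𝒩 i) i ∘ₗ
    (DirectSum.decomposeLinearEquiv 𝒩).toLinearMap

theorem prj_apply (𝒩 : ZMod 2 → Submodule K N) [DirectSum.Decomposition 𝒩] (i : ZMod 2) (n : N) :
    prj 𝒩 i n = (DirectSum.decompose 𝒩 n i : N) := rfl

theorem prj_mem (𝒩 : ZMod 2 → Submodule K N) [DirectSum.Decomposition 𝒩] (i : ZMod 2) (n : N) :
    prj 𝒩 i n ∈ 𝒩 i := (DirectSum.decompose 𝒩 n i).2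

theorem prj_of_mem (𝒩 : ZMod 2 → Submodule K N) [DirectSum.Decomposition 𝒩] (i j : ZMod 2) (n : N)
    (hn : n ∈ 𝒩 j) : prj 𝒩 i n = if i = j then n else 0 := by
  rw [prj_apply]
  split_ifs with h
  · subst h; exact DirectSum.decompose_of_mem_same _ hn
  · exact DirectSum.decompose_of_mem_ne _ hn (Ne.symm h)

theorem prj_sum (𝒩 : ZMod 2 → Submodule K N) [DirectSum.Decomposition 𝒩] (n : N) :
    ∑ i, prj 𝒩 i n = n := by
  induction n using DirectSum.Decomposition.inductionOn 𝒩 with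
  | zero => simp
  | add x y hx hy => simp only [map_add, Finset.sum_add_distrib, hx, hy]
  | homogeneous x => simp [prj_of_mem 𝒩 _ _ _ x.2]

noncomputable def sgnS (𝒩 : ZMod 2 → Submodule K N) [DirectSum.Decomposition 𝒩] (d : ZMod 2) :
    N →ₗ[K] N := ∑ i : ZMod 2, ((-1 : K) ^ (d.val * i.val)) • prj 𝒩 i

theorem sgnS_of_mem (𝒩 : ZMod 2 → Submodule K N) [DirectSum.Decomposition 𝒩] (d j : ZMod 2) (n : N)
    (hn : n ∈ 𝒩 j) : sgnS 𝒩 d n = ((-1 : K) ^ (d.val * j.val)) • n := by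
  simp [sgnS, prj_of_mem 𝒩 _ _ _ hn]

theorem sgnS_sgnS (𝒩 : ZMod 2 → Submodule K N) [DirectSum.Decomposition 𝒩] (d : ZMod 2) (n : N) :
    sgnS 𝒩 d (sgnS 𝒩 d n) = n := by
  induction n using DirectSum.Decomposition.inductionOn 𝒩 with
  | zero => simp
  | add x y hx hy => simp only [map_add, hx, hy]
  | homogeneous x =>
    rw [sgnS_of_mem 𝒩 _ _ _ x.2, map_smul, sgnS_of_mem 𝒩 _ _ _ x.2, smul_smul, sgn_sq, one_smul]

/-- right action -/
noncomputable def ract [Module A N] [IsScalarTower K A N]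
    (𝒜 : ZMod 2 → Submodule K A) [GradedAlgebra 𝒜]
    (𝒩 : ZMod 2 → Submodule K N) [DirectSum.Decomposition 𝒩] : N →ₗ[K] A →ₗ[K] N :=
  (∑ j : ZMod 2, (LinearMap.compl₂ ((Algebra.lsmul K K N).toLinearMap ∘ₗ prj 𝒜 j) (sgnS 𝒩 j))).flip

theorem ract_of_mem [Module A N] [IsScalarTower K A N]
    (𝒜 : ZMod 2 → Submodule K A) [GradedAlgebra 𝒜]
    (𝒩 : ZMod 2 → Submodule K N) [DirectSum.Decomposition 𝒩] (i j : ZMod 2) (n : N) (a : A)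
    (hn : n ∈ 𝒩 i) (ha : a ∈ 𝒜 j) :
    ract 𝒜 𝒩 n a = ((-1 : K) ^ (i.val * j.val)) • (a • n) := by
  have : ract 𝒜 𝒩 n a = ∑ k : ZMod 2, (prj 𝒜 k a) • (sgnS 𝒩 k n) := by
    simp [ract]
  rw [this, Finset.sum_eq_single j]
  · rw [prj_of_mem 𝒜 _ _ _ ha, if_pos rfl, sgnS_of_mem 𝒩 _ _ _ hn, smul_comm, sgn_comm_s16]
  · intro k _ hk; rw [prj_of_mem 𝒜 _ _ _ ha, if_neg hk, zero_smul]
  · simp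

theorem ract_one [Module A N] [IsScalarTower K A N]
    (𝒜 : ZMod 2 → Submodule K A) [GradedAlgebra 𝒜]
    (𝒩 : ZMod 2 → Submodule K N) [DirectSum.Decomposition 𝒩] (n : N) : ract 𝒜 𝒩 n 1 = n := by
  induction n using DirectSum.Decomposition.inductionOn 𝒩 with
  | zero => simp
  | add x y hx hy => simp only [map_add, LinearMap.add_apply, hx, hy]
  | homogeneous x =>
    rw [ract_of_mem 𝒜 𝒩 _ 0 _ _ x.2 SetLike.GradedOne.one_mem]; simp

theorem ract_ract [Module A N] [IsScalarTower K A N]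
    (𝒜 : ZMod 2 → Submodule K A) [GradedAlgebra 𝒜]
    (hcomm : ∀ (i j : ZMod 2) (a b : A), a ∈ 𝒜 i → b ∈ 𝒜 j →
      a * b = ((-1 : K) ^ (i.val * j.val)) • (b * a))
    (𝒩 : ZMod 2 → Submodule K N) [DirectSum.Decomposition 𝒩]
    (hNgr : ∀ (i j : ZMod 2) (a : A) (x : N), a ∈ 𝒜 i → x ∈ 𝒩 j → a • x ∈ 𝒩 (i + j))
    (n : N) (a b : A) : ract 𝒜 𝒩 (ract 𝒜 𝒩 n a) b = ract 𝒜 𝒩 n (a * b) := by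
  induction n using DirectSum.Decomposition.inductionOn 𝒩 with
  | zero => simp
  | add x y hx hy => simp only [map_add, LinearMap.add_apply, hx, hy]
  | @homogeneous i x =>
  induction a using DirectSum.Decomposition.inductionOn 𝒜 with
  | zero => simp
  | add x y hx hy => simp only [map_add, LinearMap.add_apply, hx, hy, add_mul]
  | @homogeneous j a =>
  induction b using DirectSum.Decomposition.inductionOn 𝒜 with
  | zero => simp
  | add x y hx hy => simp only [map_add, hx, hy, mul_add]
  | @homogeneous k b =>
    rw [ract_of_mem 𝒜 𝒩 i j _ _ x.2 a.2, map_smul, LinearMap.smul_apply,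
      ract_of_mem 𝒜 𝒩 _ k _ _ (hNgr _ _ _ _ a.2 x.2) b.2,
      ract_of_mem 𝒜 𝒩 i _ _ _ x.2 (SetLike.GradedMul.mul_mem a.2 b.2), hcomm j k _ _ a.2 b.2,
      smul_assoc, smul_smul, smul_smul, smul_smul, sgn_add_s16, sgn_comm_s16 (j + i), sgn_add_s16,
      sgn_comm_s16 k j, sgn_comm_s16 k i]
    congr 1
    ring

/-- homogeneous representation -/
theorem exists_rep (𝒜 : ZMod 2 → Submodule K A) [GradedAlgebra 𝒜] (z : A ⊗[K] X) :
    ∃ (n : ℕ) (a : Fin n → A) (x : Fin n → X) (e : Fin n → ZMod 2),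
      (∀ j, a j ∈ 𝒜 (e j)) ∧ z = ∑ j, a j ⊗ₜ[K] x j := by
  have key : ∀ (ι : Type) [Fintype ι] (a : ι → A) (x : ι → X) (e : ι → ZMod 2),
      (∀ j, a j ∈ 𝒜 (e j)) → z = ∑ j, a j ⊗ₜ[K] x j → ∃ (n : ℕ) (a : Fin n → A) (x : Fin n → X)
      (e : Fin n → ZMod 2), (∀ j, a j ∈ 𝒜 (e j)) ∧ z = ∑ j, a j ⊗ₜ[K] x j := by
    intro ι _ a x e h hz
    let φ := (Fintype.equivFin ι).symm
    refine ⟨_, a ∘ φ, x ∘ φ, e ∘ φ, fun j => h _, ?_⟩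
    rw [hz]
    exact (φ.sum_comp (fun j => a j ⊗ₜ[K] x j)).symm
  obtain ⟨s, hs⟩ := TensorProduct.exists_finset z
  refine key (s × ZMod 2) (fun p => prj 𝒜 p.2 p.1.1.1) (fun p => p.1.1.2) (fun p => p.2)
    (fun p => prj_mem _ _ _) ?_
  rw [hs, Fintype.sum_prod_type, ← Finset.sum_coe_sort s]
  refine Finset.sum_congr rfl fun p _ => ?_
  dsimp only
  rw [← TensorProduct.sum_tmul, prj_sum]

end helpers

section helpers2
variable {K A : Type} [Field K] [Ring A] [Algebra K A]
    {𝒜 : ZMod 2 → Submodule K A} [GradedAlgebra 𝒜]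

theorem exists_repB (H : SuperHopf K A 𝒜) (B : Subalgebra K A)
    (hBhom : ∀ x ∈ B, ∀ i : ZMod 2, GradedAlgebra.proj 𝒜 i x ∈ B)
    (hBcoideal : ∀ b ∈ B, H.comul b ∈ LinearMap.range
      (TensorProduct.map (LinearMap.id : A →ₗ[K] A) (Subalgebra.toSubmodule B).subtype))
    (b : A) (hb : b ∈ B) (d : ZMod 2) (hd : b ∈ 𝒜 d) :
    ∃ (n : ℕ) (b₁ b₂ : Fin n → A) (d₁ d₂ : Fin n → ZMod 2),
      (∀ i, b₂ i ∈ B) ∧ (∀ i, b₁ i ∈ 𝒜 (d₁ i)) ∧ (∀ i, b₂ i ∈ 𝒜 (d₂ i)) ∧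
      (∀ i, d₁ i + d₂ i = d) ∧ H.comul b = ∑ i, b₁ i ⊗ₜ[K] b₂ i := by
  have key : ∀ (ι : Type) [Fintype ι] (b₁ b₂ : ι → A) (d₁ d₂ : ι → ZMod 2),
      (∀ i, b₂ i ∈ B) → (∀ i, b₁ i ∈ 𝒜 (d₁ i)) → (∀ i, b₂ i ∈ 𝒜 (d₂ i)) →
      (∀ i, d₁ i + d₂ i = d) → H.comul b = ∑ i, b₁ i ⊗ₜ[K] b₂ i →
      ∃ (n : ℕ) (b₁ b₂ : Fin n → A) (d₁ d₂ : Fin n → ZMod 2),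
      (∀ i, b₂ i ∈ B) ∧ (∀ i, b₁ i ∈ 𝒜 (d₁ i)) ∧ (∀ i, b₂ i ∈ 𝒜 (d₂ i)) ∧
      (∀ i, d₁ i + d₂ i = d) ∧ H.comul b = ∑ i, b₁ i ⊗ₜ[K] b₂ i := by
    intro ι _ b₁ b₂ d₁ d₂ h1 h2 h3 h4 hz
    let φ := (Fintype.equivFin ι).symm
    refine ⟨_, b₁ ∘ φ, b₂ ∘ φ, d₁ ∘ φ, d₂ ∘ φ, fun j => h1 _, fun j => h2 _, fun j => h3 _,
      fun j => h4 _, ?_⟩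
    rw [hz]
    exact (φ.sum_comp (fun j => b₁ j ⊗ₜ[K] b₂ j)).symm
  have hfix : (∑ j : ZMod 2, TensorProduct.map (prj 𝒜 j) (prj 𝒜 (d - j))) (H.comul b)
      = H.comul b := by
    have h := H.comul_graded d b hd
    have hle : (⨆ j : ZMod 2, LinearMap.range
        (TensorProduct.map ((𝒜 j).subtype) ((𝒜 (d - j)).subtype))) ≤
        LinearMap.eqLocus (∑ j : ZMod 2, TensorProduct.map (prj 𝒜 j) (prj 𝒜 (d - j)))
          LinearMap.id := by
      refine iSup_le fun j => ?_
      rintro _ ⟨z, rfl⟩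
      rw [LinearMap.mem_eqLocus]
      induction z with
      | zero => simp
      | add x y hx hy => simp only [map_add, hx, hy]
      | tmul x y =>
        rw [LinearMap.sum_apply, Finset.sum_eq_single j]
        · simp [prj_of_mem 𝒜 _ _ _ x.2, prj_of_mem 𝒜 _ _ _ y.2]
        · intro k _ hk
          simp [prj_of_mem 𝒜 _ _ _ x.2, hk]
        · simp
    exact hle h
  obtain ⟨w, hw⟩ := hBcoideal b hb
  obtain ⟨s, hs⟩ := TensorProduct.exists_finset w
  refine key (s × ZMod 2) (fun p => prj 𝒜 p.2 p.1.1.1) (fun p => prj 𝒜 (d - p.2) p.1.1.2)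
    (fun p => p.2) (fun p => d - p.2) (fun p => hBhom _ p.1.1.2.2 _)
    (fun p => prj_mem _ _ _) (fun p => prj_mem _ _ _) (fun p => by abel) ?_
  rw [← hfix, ← hw, hs, Fintype.sum_prod_type, map_sum, map_sum, ← Finset.sum_coe_sort s]
  refine Finset.sum_congr rfl fun p _ => ?_
  simp [LinearMap.sum_apply]

theorem exists_coactB (H : SuperHopf K A 𝒜) (B : Subalgebra K A)
    (hBcoideal : ∀ b ∈ B, H.comul b ∈ LinearMap.range
      (TensorProduct.map (LinearMap.id : A →ₗ[K] A) (Subalgebra.toSubmodule B).subtype)) :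
    ∃ δB : B →ₗ[K] A ⊗[K] B,
      (∀ b : B, B.val.toLinearMap.lTensor A (δB b) = H.comul b) ∧
      ((TensorProduct.lid K B).toLinearMap ∘ₗ TensorProduct.map H.counit LinearMap.id ∘ₗ δB
        = LinearMap.id) ∧
      (TensorProduct.map LinearMap.id δB ∘ₗ δB
        = (TensorProduct.assoc K A A B).toLinearMap ∘ₗ
          TensorProduct.map H.comul LinearMap.id ∘ₗ δB) := by
  have hinj0 : Function.Injective (B.val.toLinearMap) := Subtype.val_injective
  have hinj : Function.Injective (B.val.toLinearMap.lTensor A) :=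
    Module.Flat.lTensor_preserves_injective_linearMap _ hinj0
  have hinj2 : Function.Injective ((B.val.toLinearMap.lTensor A).lTensor A) :=
    Module.Flat.lTensor_preserves_injective_linearMap _ hinj
  let δB : B →ₗ[K] A ⊗[K] B := (LinearEquiv.ofInjective _ hinj).symm.toLinearMap ∘ₗ
    (H.comul ∘ₗ B.val.toLinearMap).codRestrict _ (fun b => hBcoideal b b.2)
  have h1 : ∀ b : B, B.val.toLinearMap.lTensor A (δB b) = H.comul b := by
    intro b
    exact congrArg Subtype.val ((LinearEquiv.ofInjective _ hinj).apply_symm_apply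
      ((H.comul ∘ₗ B.val.toLinearMap).codRestrict _ (fun b => hBcoideal b b.2) b))
  refine ⟨δB, h1, ?_, ?_⟩
  · ext b
    have h := LinearMap.congr_fun H.counit_left (b : A)
    simp only [LinearMap.comp_apply, LinearEquiv.coe_coe, LinearMap.id_apply] at h ⊢
    rw [← h1] at h
    rw [← h]
    generalize δB b = z
    induction z with
    | zero => simp
    | add x y hx hy => simp only [map_add, Subalgebra.coe_add, hx, hy]
    | tmul x y => simp
  · apply LinearMap.ext
    intro b
    apply hinj2
    have h := LinearMap.congr_fun H.coassoc (b : A)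
    simp only [LinearMap.comp_apply, LinearEquiv.coe_coe] at h ⊢
    rw [← h1] at h
    have e1 : ∀ z : A ⊗[K] B, (B.val.toLinearMap.lTensor A).lTensor A
        (TensorProduct.map LinearMap.id δB z) =
        TensorProduct.map LinearMap.id H.comul (B.val.toLinearMap.lTensor A z) := by
      intro z
      induction z with
      | zero => simp
      | add x y hx hy => simp only [map_add, hx, hy]
      | tmul x y => simp only [TensorProduct.map_tmul, LinearMap.lTensor_tmul, h1]; rfl
    have e2 : ∀ z : A ⊗[K] B, (B.val.toLinearMap.lTensor A).lTensor A
        (TensorProduct.assoc K A A B (TensorProduct.map H.comul LinearMap.id z)) =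
        TensorProduct.assoc K A A A
          (TensorProduct.map H.comul LinearMap.id (B.val.toLinearMap.lTensor A z)) := by
      intro z
      induction z with
      | zero => simp
      | add x y hx hy => simp only [map_add, hx, hy]
      | tmul x y =>
        simp only [TensorProduct.map_tmul, LinearMap.lTensor_tmul, LinearMap.id_apply]
        generalize H.comul x = w
        induction w with
        | zero => simp
        | add x y hx hy => simp only [map_add, TensorProduct.add_tmul, hx, hy]
        | tmul x y => simp
    rw [e1, e2, h]

end helpers2

/-- for a left coideal supersubalgebra B of a supercommutative Hopf
superalgebra A, a right A-supermodule N and a left B-supermodule M with a compatible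
left A-supercomodule structure τ_M, the map ξ(n ⊗ m) = Σ na₁ ⊗ m₂ induces an isomorphism
N ⊗_B M ≅ N ⊗ (M/B⁺M), where B⁺ = B ∩ ker ε. (The right A-action on N is written through
the left action via the sign rule n·a = (-1)^{|n||a|} a•n, and N ⊗_B M is presented as the
quotient of N ⊗_K M by the relations n·b ⊗ m − n ⊗ b·m.) -/
theorem coideal_subalgebra_tensor_iso
    {K A : Type} [Field K] (hK : (2 : K) ≠ 0)
    [Ring A] [Algebra K A] (𝒜 : ZMod 2 → Submodule K A) [GradedAlgebra 𝒜]
    (hcomm : ∀ (i j : ZMod 2) (a b : A), a ∈ 𝒜 i → b ∈ 𝒜 j →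
      a * b = ((-1 : K) ^ (i.val * j.val)) • (b * a))
    (H : SuperHopf K A 𝒜)
    (B : Subalgebra K A)
    (hBhom : ∀ x ∈ B, ∀ i : ZMod 2, GradedAlgebra.proj 𝒜 i x ∈ B)
    (hBcoideal : ∀ b ∈ B, H.comul b ∈ LinearMap.range
      (TensorProduct.map (LinearMap.id : A →ₗ[K] A) (Subalgebra.toSubmodule B).subtype))
    -- N : a right A-supermodule
    {N : Type} [AddCommGroup N] [Module K N] [Module A N] [IsScalarTower K A N]
    (𝒩 : ZMod 2 → Submodule K N) [DirectSum.Decomposition 𝒩]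
    (hNgr : ∀ (i j : ZMod 2) (a : A) (x : N), a ∈ 𝒜 i → x ∈ 𝒩 j → a • x ∈ 𝒩 (i + j))
    -- M : a left B-supermodule which is an A-supercomodule, M ∈ _B𝓗
    {M : Type} [AddCommGroup M] [Module K M] [Module B M]
    [IsScalarTower K B M] [SMulCommClass K B M]
    (ℳ : ZMod 2 → Submodule K M) [DirectSum.Decomposition ℳ]
    (τM : M →ₗ[K] A ⊗[K] M)
    (hcounit : (TensorProduct.lid K M).toLinearMap ∘ₗ
      TensorProduct.map H.counit LinearMap.id ∘ₗ τM = LinearMap.id)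
    (hcoassoc : TensorProduct.map LinearMap.id τM ∘ₗ τM
      = (TensorProduct.assoc K A A M).toLinearMap ∘ₗ TensorProduct.map H.comul LinearMap.id ∘ₗ τM)
    -- the compatibility τ_M(bm) = Σ (-1)^{|b₂||a₁|} b₁a₁ ⊗ b₂m₂:
    (hcompat : ∀ (b : B) (m : M) (n₁ n₂ : ℕ)
      (b₁ b₂ : Fin n₁ → A) (d : Fin n₁ → ZMod 2)
      (a : Fin n₂ → A) (m₂ : Fin n₂ → M) (e : Fin n₂ → ZMod 2)
      (hb₂B : ∀ i, b₂ i ∈ B),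
      (∀ i, b₂ i ∈ 𝒜 (d i)) → (∀ j, a j ∈ 𝒜 (e j)) →
      H.comul (b : A) = ∑ i : Fin n₁, b₁ i ⊗ₜ[K] b₂ i →
      τM m = ∑ j : Fin n₂, a j ⊗ₜ[K] m₂ j →
      τM (b • m) = ∑ i : Fin n₁, ∑ j : Fin n₂,
        ((-1 : K) ^ ((d i).val * (e j).val)) •
          ((b₁ i * a j) ⊗ₜ[K] ((⟨b₂ i, hb₂B i⟩ : B) • m₂ j))) :
    -- conclusion: ξ induces N ⊗_B M ≅ N ⊗ (M/B⁺M)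
    ∀ Rel : Submodule K (N ⊗[K] M),
      Rel = Submodule.span K {x : N ⊗[K] M |
        ∃ (i j : ZMod 2) (b : A) (hb : b ∈ B), b ∈ 𝒜 j ∧ ∃ n : N, n ∈ 𝒩 i ∧ ∃ m : M,
          x = (((-1 : K) ^ (i.val * j.val)) • (b • n)) ⊗ₜ[K] m
              - n ⊗ₜ[K] ((⟨b, hb⟩ : B) • m)} →
    ∀ Bplus : Submodule K M,
      Bplus = Submodule.span K {y : M |
        ∃ b : B, H.counit (b : A) = 0 ∧ ∃ m : M, y = b • m} →
    ∃ e : ((N ⊗[K] M) ⧸ Rel) ≃ₗ[K] (N ⊗[K] (M ⧸ Bplus)),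
      ∀ (n : N) (m : M) (i : ZMod 2), n ∈ 𝒩 i →
        ∀ (nn : ℕ) (a : Fin nn → A) (m₂ : Fin nn → M) (f : Fin nn → ZMod 2),
          (∀ j, a j ∈ 𝒜 (f j)) →
          τM m = ∑ j : Fin nn, a j ⊗ₜ[K] m₂ j →
          e (Submodule.Quotient.mk (n ⊗ₜ[K] m)) = ∑ j : Fin nn,
            ((-1 : K) ^ (i.val * (f j).val)) •
              ((a j • n) ⊗ₜ[K] (Submodule.Quotient.mk (m₂ j) : M ⧸ Bplus)) := by
  intro Rel hRel Bplus hBplus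
  obtain ⟨δB, hδ, hδc, hδco⟩ := exists_coactB H B hBcoideal
  have hinj : Function.Injective (B.val.toLinearMap.lTensor A) :=
    Module.Flat.lTensor_preserves_injective_linearMap _ Subtype.val_injective
  set r : N →ₗ[K] A →ₗ[K] N := ract 𝒜 𝒩 with hr_def
  have hr := ract_ract 𝒜 hcomm 𝒩 hNgr
  have hr1 := ract_one 𝒜 𝒩
  rw [← hr_def] at hr hr1
  let ξ := EEequiv r hr hr1 𝒜 H τM hcounit hcoassoc
  let EB := EEequiv r hr hr1 𝒜 H δB hδc hδco
  have hξ : ∀ n m, ξ (n ⊗ₜ m) = PPx M r LinearMap.id n (τM m) := fun n m => rfl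
  have hEB : ∀ n b, EB (n ⊗ₜ b) = PPx B r LinearMap.id n (δB b) := fun n m => rfl
  let psi : B →ₗ[K] M →ₗ[K] M := (LinearMap.lsmul K M) ∘ₗ H.counit ∘ₗ B.val.toLinearMap -
    (Algebra.lsmul K K M).toLinearMap
  have hpsi : ∀ b m, psi b m = H.counit (b : A) • m - b • m := fun b m => rfl
  let D : B → (N ⊗[K] M →ₗ[K] N ⊗[K] M) := fun b => TensorProduct.lift
    ((LinearMap.lTensorHom N ∘ₗ psi.flip).flip ∘ₗ EB.toLinearMap ∘ₗ (TensorProduct.mk K N B).flip b)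
  have hD : ∀ b n m, D b (n ⊗ₜ m) = (psi.flip m).lTensor N (EB (n ⊗ₜ b)) := fun b n m => rfl
  let T : ZMod 2 → (N ⊗[K] M →ₗ[K] N ⊗[K] M) := fun d => (sgnS 𝒩 d).rTensor M
  have hTT : ∀ d y, T d (T d y) = y := by
    intro d y
    induction y with
    | zero => simp
    | add x y hx hy => simp only [map_add, hx, hy]
    | tmul n m => simp [T, sgnS_sgnS]
  have key : ∀ (i d : ZMod 2) (b : A) (hb : b ∈ B), b ∈ 𝒜 d → ∀ n ∈ 𝒩 i, ∀ m : M,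
      ξ ((((-1 : K) ^ (i.val * d.val)) • (b • n)) ⊗ₜ[K] m - n ⊗ₜ[K] ((⟨b, hb⟩ : B) • m))
      = ((-1 : K) ^ (d.val * i.val)) • D ⟨b, hb⟩ (T d (ξ (n ⊗ₜ m))) := by
    intro i d b hb hbd n hn m
    obtain ⟨n₁, b₁, b₂, d₁, d₂, hb₂, hd₁, hd₂, hdd, hrep⟩ :=
      exists_repB H B hBhom hBcoideal b hb d hbd
    obtain ⟨n₂, a, m₂, e, ha, hτ⟩ := exists_rep 𝒜 (τM m)
    have hτb := hcompat ⟨b, hb⟩ m n₁ n₂ b₁ b₂ d₂ a m₂ e hb₂ hd₂ ha hrep hτ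
    have hδb : δB ⟨b, hb⟩ = ∑ i, b₁ i ⊗ₜ[K] (⟨b₂ i, hb₂ i⟩ : B) := by
      apply hinj
      rw [hδ, map_sum]
      exact hrep
    have hcr : ∑ i, H.counit (b₂ i) • b₁ i = b := by
      have h := LinearMap.congr_fun H.counit_right b
      simp only [LinearMap.comp_apply, hrep, map_sum] at h
      simpa using h
    have hDb : ∀ n' m', D ⟨b, hb⟩ (n' ⊗ₜ m') = r n' b ⊗ₜ m' -
        ∑ i, r n' (b₁ i) ⊗ₜ ((⟨b₂ i, hb₂ i⟩ : B) • m') := by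
      intro n' m'
      rw [hD, hEB, hδb, map_sum, map_sum]
      simp only [PPx_tmul, LinearMap.lTensor_tmul, LinearMap.flip_apply, hpsi,
        TensorProduct.tmul_sub, Finset.sum_sub_distrib, LinearMap.id_apply]
      congr 1
      rw [← hcr, map_sum, TensorProduct.sum_tmul]
      refine Finset.sum_congr rfl fun i _ => ?_
      rw [map_smul, TensorProduct.smul_tmul]
    rw [← ract_of_mem 𝒜 𝒩 i d n b hn hbd, ← hr_def, map_sub, hξ, hξ, hξ, hτb, hτ]
    simp only [map_sum, map_smul, PPx_tmul, LinearMap.id_apply]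
    rw [Finset.sum_comm, ← Finset.sum_sub_distrib, Finset.smul_sum]
    refine Finset.sum_congr rfl fun j _ => ?_
    have hmem : r n (a j) ∈ 𝒩 (e j + i) := by
      rw [hr_def, ract_of_mem 𝒜 𝒩 i (e j) n (a j) hn (ha j)]
      exact Submodule.smul_mem _ _ (hNgr _ _ _ _ (ha j) hn)
    have hTj : T d (r n (a j) ⊗ₜ m₂ j) =
        ((-1 : K) ^ (d.val * (e j + i).val)) • (r n (a j) ⊗ₜ m₂ j) := by
      simp only [T, LinearMap.rTensor_tmul, sgnS_of_mem 𝒩 d _ _ hmem, TensorProduct.smul_tmul']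
    rw [hTj, map_smul, hDb, smul_smul, sgn_add_s16, mul_left_comm, sgn_sq, mul_one, smul_sub,
      Finset.smul_sum]
    congr 1
    · rw [hr, hr, hcomm d (e j) b (a j) hbd (ha j), map_smul, TensorProduct.smul_tmul']
    · refine Finset.sum_congr rfl fun k _ => ?_
      rw [hr, hcomm (d₁ k) (e j) (b₁ k) (a j) (hd₁ k) (ha j), map_smul, ← TensorProduct.smul_tmul',
        smul_smul, ← hdd k, sgn_comm_s16 (d₁ k + d₂ k), sgn_add_s16, sgn_comm_s16 (e j) (d₁ k),
        sgn_comm_s16 (e j) (d₂ k), mul_comm]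
  have hmap : Rel.map (ξ : N ⊗[K] M →ₗ[K] N ⊗[K] M)
      = LinearMap.range (Bplus.subtype.lTensor N) := by
    apply le_antisymm
    · rw [hRel, Submodule.map_span_le]
      rintro _ ⟨i, d, b, hb, hbd, n, hn, m, rfl⟩
      rw [LinearEquiv.coe_coe, key i d b hb hbd n hn m]
      refine Submodule.smul_mem _ _ ?_
      generalize T d (ξ (n ⊗ₜ m)) = y
      induction y with
      | zero => simp
      | add x y hx hy => rw [map_add]; exact Submodule.add_mem _ hx hy
      | tmul n m =>
        rw [hD]
        generalize EB (n ⊗ₜ[K] (⟨b, hb⟩ : B)) = w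
        induction w with
        | zero => simp
        | add x y hx hy => rw [map_add]; exact Submodule.add_mem _ hx hy
        | tmul n' b' =>
          have hmem : psi b' m ∈ Bplus := by
            rw [hBplus]
            apply Submodule.subset_span
            refine ⟨algebraMap K B (H.counit b') - b', ?_, m, ?_⟩
            · simp [Algebra.algebraMap_eq_smul_one, H.counit_one]
            · rw [hpsi, sub_smul, algebraMap_smul]
          exact ⟨n' ⊗ₜ ⟨psi b' m, hmem⟩, rfl⟩
    · set R := Rel.map (ξ : N ⊗[K] M →ₗ[K] N ⊗[K] M) with hR
      have c1 : ∀ (d : ZMod 2) (b : A) (hb : b ∈ B), b ∈ 𝒜 d → ∀ y, D ⟨b, hb⟩ y ∈ R := by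
        intro d b hb hbd y
        obtain ⟨z, hz⟩ : ∃ z, T d (ξ z) = y := ⟨ξ.symm (T d y), by simp [hTT]⟩
        rw [← hz]
        clear hz
        induction z with
        | zero => simp
        | add x y hx hy => simp only [map_add]; exact Submodule.add_mem _ hx hy
        | tmul n m =>
          induction n using DirectSum.Decomposition.inductionOn 𝒩 with
          | zero => simp
          | add x y hx hy =>
            simp only [map_add, TensorProduct.add_tmul]; exact Submodule.add_mem _ hx hy
          | @homogeneous i n =>
            have hk := key i d b hb hbd n n.2 m
            have h2 : D ⟨b, hb⟩ (T d (ξ ((n : N) ⊗ₜ m))) = ((-1 : K) ^ (d.val * i.val)) •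
              ((-1 : K) ^ (d.val * i.val)) • D ⟨b, hb⟩ (T d (ξ ((n : N) ⊗ₜ m))) := by
              rw [smul_smul, sgn_sq, one_smul]
            rw [h2, ← hk]
            refine Submodule.smul_mem _ _ (Submodule.mem_map_of_mem ?_)
            rw [hRel]
            exact Submodule.subset_span ⟨i, d, b, hb, hbd, n, n.2, m, rfl⟩
      have c2 : ∀ (m : M) (w : N ⊗[K] B), (psi.flip m).lTensor N w ∈ R := by
        intro m w
        obtain ⟨z, rfl⟩ := EB.surjective w
        induction z with
        | zero => simp
        | add x y hx hy => simp only [map_add]; exact Submodule.add_mem _ hx hy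
        | tmul n b =>
          have hbs : b = ∑ d : ZMod 2, (⟨prj 𝒜 d b, hBhom _ b.2 d⟩ : B) := by
            apply Subtype.ext
            rw [AddSubmonoidClass.coe_finsetSum]
            exact (prj_sum 𝒜 (b : A)).symm
          rw [hbs, TensorProduct.tmul_sum, map_sum, map_sum]
          refine Submodule.sum_mem _ fun d _ => ?_
          rw [← hD]
          exact c1 d _ _ (prj_mem _ _ _) _
      have c3 : ∀ y ∈ Bplus, ∀ n : N, n ⊗ₜ[K] y ∈ R := by
        intro y hy n
        have hle : Bplus ≤ R.comap (TensorProduct.mk K N M n) := by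
          rw [hBplus, Submodule.span_le]
          rintro _ ⟨b, hb, m, rfl⟩
          have h := c2 m (n ⊗ₜ b)
          rw [LinearMap.lTensor_tmul, LinearMap.flip_apply, hpsi, hb, zero_smul, zero_sub,
            TensorProduct.tmul_neg] at h
          exact (Submodule.neg_mem_iff R).1 h
        exact hle hy
      rintro _ ⟨z, rfl⟩
      induction z with
      | zero => simp
      | add x y hx hy => rw [map_add]; exact Submodule.add_mem _ hx hy
      | tmul n y => exact c3 y y.2 n
  have hex : Function.Exact Bplus.subtype Bplus.mkQ := LinearMap.exact_subtype_mkQ Bplus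
  refine ⟨(Submodule.Quotient.equiv Rel _ ξ hmap).trans
    (lTensor.equiv N hex (Submodule.mkQ_surjective _)), ?_⟩
  intro n m i hn nn a m₂ f ha hτ
  have h0 : ((Submodule.Quotient.equiv Rel _ ξ hmap).trans
    (lTensor.equiv N hex (Submodule.mkQ_surjective _))) (Submodule.Quotient.mk (n ⊗ₜ[K] m))
    = Bplus.mkQ.lTensor N (ξ (n ⊗ₜ m)) := rfl
  rw [h0, hξ, hτ, map_sum, map_sum]
  refine Finset.sum_congr rfl fun j _ => ?_
  rw [PPx_tmul, LinearMap.lTensor_tmul, LinearMap.id_apply, hr_def,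
    ract_of_mem 𝒜 𝒩 i (f j) n (a j) hn (ha j), TensorProduct.smul_tmul']
  rfl
end

section
/- Let K have characteristic 0 and let R = K ⊕ R₁ be a supercommutative superalgebra with R₁² = 0 and R₁ ≠ 0 (e.g. R₁ = span of {v₁ᵗ v₂ : t ≥ 0} inside the free supercommutative algebra S = K[v₁ | v₂] on one even generator v₁ and one odd generator v₂, with R embedded as the invariants of the odd translation action). Then S = K[v₁|v₂] is NOT a free R-module; in fact S is not even a faithfully flat R-supermodule, and consequently the quotient sheaf of SSp S by the free action of the odd additive supergroup G_a⁻ is not an affine superscheme. -/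
open TensorProduct

/-- Compatibility of a ℤ/2-grading on a module with a distinguished odd part of the
base ring: the grading is a direct sum decomposition and odd scalars switch parity. -/
def IsSuperGrading (K : Type) [Field K] (R : Type) [CommRing R] [Algebra K R]
    (Rodd : Set R) (V : Type) [AddCommGroup V] [Module K V] [Module R V]
    [IsScalarTower K R V] (V₀ V₁ : Submodule K V) : Prop :=
  IsCompl V₀ V₁ ∧ (∀ r ∈ Rodd, ∀ v ∈ V₀, r • v ∈ V₁) ∧ (∀ r ∈ Rodd, ∀ v ∈ V₁, r • v ∈ V₀)

/-- `M` (with grading `M₀, M₁`) is a faithfully flat `R`-supermodule: tensoring with `M`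
preserves injectivity of graded maps of `R`-supermodules, and tensoring with `M` kills no
nonzero `R`-supermodule. -/
def IsFaithfullyFlatSupermodule (K : Type) [Field K] (R : Type) [CommRing R] [Algebra K R]
    (Rodd : Set R) (M : Type) [AddCommGroup M] [Module K M] [Module R M]
    [IsScalarTower K R M] (M₀ M₁ : Submodule K M) : Prop :=
  IsSuperGrading K R Rodd M M₀ M₁ ∧
  (∀ (V : Type) [AddCommGroup V] [Module K V] [Module R V] [IsScalarTower K R V]
    (W : Type) [AddCommGroup W] [Module K W] [Module R W] [IsScalarTower K R W]
    (V₀ V₁ : Submodule K V) (W₀ W₁ : Submodule K W),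
    IsSuperGrading K R Rodd V V₀ V₁ → IsSuperGrading K R Rodd W W₀ W₁ →
    ∀ f : V →ₗ[R] W, (∀ v ∈ V₀, f v ∈ W₀) → (∀ v ∈ V₁, f v ∈ W₁) →
      Function.Injective f → Function.Injective (LinearMap.lTensor M f)) ∧
  (∀ (V : Type) [AddCommGroup V] [Module K V] [Module R V] [IsScalarTower K R V]
    (V₀ V₁ : Submodule K V), IsSuperGrading K R Rodd V V₀ V₁ →
    (∃ v : V, v ≠ 0) → ∃ z : M ⊗[R] V, z ≠ 0)

abbrev SS (K : Type) [Field K] := TrivSqZeroExt (Polynomial K) (Polynomial K)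

def oddIdeal (K : Type) [Field K] (R : Subalgebra K (SS K)) : Ideal R where
  carrier := {r | TrivSqZeroExt.fst (r : SS K) = 0}
  add_mem' := by
    intro a b ha hb
    simp only [Set.mem_ofPred_eq] at *
    simp [ha, hb]
  zero_mem' := by simp
  smul_mem' := by
    intro c x hx
    simp only [Set.mem_ofPred_eq] at *
    simp [hx]

noncomputable instance instOddAdd (K : Type) [Field K] (R : Subalgebra K (SS K)) :
    AddCommGroup (oddIdeal K R) := Submodule.addCommGroup _

noncomputable instance instOddMod (K : Type) [Field K] (R : Subalgebra K (SS K)) :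
    Module R (oddIdeal K R) := Submodule.module _

noncomputable instance instOddModK (K : Type) [Field K] (R : Subalgebra K (SS K)) :
    Module K (oddIdeal K R) := Submodule.module' _

noncomputable instance instOddSMul (K : Type) [Field K] (R : Subalgebra K (SS K)) :
    SMul R (oddIdeal K R) := (instOddMod K R).toSMul

noncomputable instance instOddSMulK (K : Type) [Field K] (R : Subalgebra K (SS K)) :
    SMul K (oddIdeal K R) := (instOddModK K R).toSMul

instance instOddTower (K : Type) [Field K] (R : Subalgebra K (SS K)) :
    IsScalarTower K R (oddIdeal K R) := Submodule.isScalarTower' _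

theorem mem_oddIdeal (K : Type) [Field K] (R : Subalgebra K (SS K)) (r : R) :
    r ∈ oddIdeal K R ↔ TrivSqZeroExt.fst (r : SS K) = 0 := Iff.rfl

theorem fst_const (K : Type) [Field K] (x : SS K)
    (hx : x ∈ Algebra.adjoin K {x : SS K | TrivSqZeroExt.fst x = 0}) :
    ∃ c : K, TrivSqZeroExt.fst x = Polynomial.C c := by
  induction hx using Algebra.adjoin_induction with
  | mem x hx => exact ⟨0, by simpa using hx⟩
  | algebraMap r => exact ⟨r, by simp [TrivSqZeroExt.algebraMap_eq_inl']⟩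
  | add x y _ _ hx hy =>
    obtain ⟨a, ha⟩ := hx
    obtain ⟨b, hb⟩ := hy
    exact ⟨a + b, by simp [ha, hb]⟩
  | mul x y _ _ hx hy =>
    obtain ⟨a, ha⟩ := hx
    obtain ⟨b, hb⟩ := hy
    exact ⟨a * b, by simp [ha, hb]⟩

noncomputable def pairing (K : Type) [Field K] (R : Subalgebra K (SS K))
    (hR : ∀ x ∈ R, ∃ c : K, TrivSqZeroExt.fst x = Polynomial.C c) :
    SS K →ₗ[R] oddIdeal K R →ₗ[R] SS K :=
  LinearMap.mk₂ R
    (fun s m => TrivSqZeroExt.inr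
      (Polynomial.derivative (TrivSqZeroExt.fst s) * TrivSqZeroExt.snd ((m : R) : SS K)))
    (by intro a b m; ext <;> simp [add_mul])
    (by
      rintro ⟨r, hr⟩ s m
      obtain ⟨c, hc⟩ := hR r hr
      refine TrivSqZeroExt.ext ?_ ?_
      · simp [Subalgebra.smul_def]
      · simp [Subalgebra.smul_def, hc]
        ring_nf
        try simp [Polynomial.smul_eq_C_mul]
        try ring)
    (by intro a b m; ext <;> simp [mul_add])
    (by
      rintro ⟨r, hr⟩ s ⟨m, hm⟩
      rw [mem_oddIdeal] at hm
      obtain ⟨c, hc⟩ := hR r hr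
      refine TrivSqZeroExt.ext ?_ ?_
      · simp [Subalgebra.smul_def]
      · simp [Subalgebra.smul_def, hc, hm]
        try simp [Polynomial.smul_eq_C_mul]
        try ring)

set_option synthInstance.maxHeartbeats 400000 in
set_option maxHeartbeats 1000000 in
theorem not_inj (K : Type) [Field K] (R : Subalgebra K (SS K))
    (hR : ∀ x ∈ R, ∃ c : K, TrivSqZeroExt.fst x = Polynomial.C c)
    (hm : ∀ p : Polynomial K, (TrivSqZeroExt.inr p : SS K) ∈ R) :
    ¬ Function.Injective (LinearMap.lTensor (SS K) (oddIdeal K R).subtype) := by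
  intro hinj
  let e : Polynomial K → oddIdeal K R := fun p => ⟨⟨TrivSqZeroExt.inr p, hm p⟩, by
    rw [mem_oddIdeal]; simp⟩
  have key : (TrivSqZeroExt.inl Polynomial.X : SS K) ⊗ₜ[R] e 1
      = (1 : SS K) ⊗ₜ[R] e Polynomial.X := by
    apply hinj
    apply (TensorProduct.rid R (SS K)).injective
    simp only [LinearMap.lTensor_tmul, TensorProduct.rid_tmul, Submodule.subtype_apply,
      Subalgebra.smul_def, e]
    ext <;> simp
  have h2 := congrArg (fun z => TrivSqZeroExt.snd (TensorProduct.lift (pairing K R hR) z)) key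
  simp [pairing, e] at h2

set_option synthInstance.maxHeartbeats 400000 in
set_option maxHeartbeats 1000000 in
theorem grading_odd (K : Type) [Field K] (R : Subalgebra K (SS K)) :
    IsSuperGrading K R {r : R | TrivSqZeroExt.fst (r : SS K) = 0} (oddIdeal K R) ⊥ ⊤ := by
  refine ⟨isCompl_bot_top, fun _ _ _ _ => trivial, ?_⟩
  rintro ⟨r, hr⟩ hr0 ⟨⟨m, hmR⟩, hm⟩ -
  rw [mem_oddIdeal] at hm
  simp only [Set.mem_ofPred_eq] at hr0 hm
  rw [Submodule.mem_bot]
  apply Subtype.ext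
  apply Subtype.ext
  change r * m = 0
  ext <;> simp [hr0, hm]

def evenR (K : Type) [Field K] (R : Subalgebra K (SS K)) : Submodule K R where
  carrier := {r | TrivSqZeroExt.snd (r : SS K) = 0}
  add_mem' := by
    intro a b ha hb
    simp only [Set.mem_ofPred_eq] at *
    simp [ha, hb]
  zero_mem' := by simp
  smul_mem' := by
    intro c x hx
    simp only [Set.mem_ofPred_eq] at *
    simp [hx]

theorem mem_evenR (K : Type) [Field K] (R : Subalgebra K (SS K)) (r : R) :
    r ∈ evenR K R ↔ TrivSqZeroExt.snd (r : SS K) = 0 := Iff.rfl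

theorem grading_R (K : Type) [Field K] (R : Subalgebra K (SS K))
    (hR : ∀ x ∈ R, ∃ c : K, TrivSqZeroExt.fst x = Polynomial.C c) :
    IsSuperGrading K R {r : R | TrivSqZeroExt.fst (r : SS K) = 0} R (evenR K R)
      ((oddIdeal K R).restrictScalars K) := by
  refine ⟨⟨?_, ?_⟩, ?_, ?_⟩
  · rw [Submodule.disjoint_def]
    intro x hx hy
    rw [mem_evenR] at hx
    rw [Submodule.restrictScalars_mem, mem_oddIdeal] at hy
    apply Subtype.ext
    exact TrivSqZeroExt.ext hy hx
  · rw [codisjoint_iff, Submodule.eq_top_iff']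
    intro x
    obtain ⟨c, hc⟩ := hR x x.2
    rw [Submodule.mem_sup]
    refine ⟨algebraMap K R c, ?_, x - algebraMap K R c, ?_, by simp⟩
    · rw [mem_evenR]; simp [TrivSqZeroExt.algebraMap_eq_inl']
    · rw [Submodule.restrictScalars_mem, mem_oddIdeal]
      simp [TrivSqZeroExt.algebraMap_eq_inl', hc]
  · intro r hr v _
    simp only [Set.mem_ofPred_eq] at hr
    rw [Submodule.restrictScalars_mem, mem_oddIdeal]
    simp [hr]
  · intro r hr v hv
    simp only [Set.mem_ofPred_eq] at hr
    rw [Submodule.restrictScalars_mem, mem_oddIdeal] at hv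
    rw [mem_evenR]
    simp [hr, hv]

/-- over a field of characteristic 0, let S = K[v₁|v₂] be the free
supercommutative algebra on one even and one odd generator (realized as the trivial
square-zero extension K[v₁] ⊕ K[v₁]·v₂), and let R = K ⊕ K[v₁]v₂ be the invariant
subalgebra of the odd translation action (the subalgebra generated by the odd part).
Then S is not a free R-module and not a faithfully flat R-supermodule (hence the quotient
of SSp S by the free action of the odd additive supergroup G_a⁻ is not affine). -/
theorem free_superalgebra_not_free_over_invariants (K : Type) [Field K] [CharZero K] :
    ∀ R : Subalgebra K (TrivSqZeroExt (Polynomial K) (Polynomial K)),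
      R = Algebra.adjoin K
          {x : TrivSqZeroExt (Polynomial K) (Polynomial K) | TrivSqZeroExt.fst x = 0} →
      ¬ Module.Free R (TrivSqZeroExt (Polynomial K) (Polynomial K)) ∧
      ∀ S₀ S₁ : Submodule K (TrivSqZeroExt (Polynomial K) (Polynomial K)),
        (S₀ : Set (TrivSqZeroExt (Polynomial K) (Polynomial K)))
            = {x | TrivSqZeroExt.snd x = 0} →
        (S₁ : Set (TrivSqZeroExt (Polynomial K) (Polynomial K)))
            = {x | TrivSqZeroExt.fst x = 0} →
        ¬ IsFaithfullyFlatSupermodule K R {r : R | TrivSqZeroExt.fst (r : TrivSqZeroExt (Polynomial K) (Polynomial K)) = 0}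
            (TrivSqZeroExt (Polynomial K) (Polynomial K)) S₀ S₁ := by
  intro R hRdef
  have hR : ∀ x ∈ R, ∃ c : K, TrivSqZeroExt.fst x = Polynomial.C c := by
    intro x hx
    rw [hRdef] at hx
    exact fst_const K x hx
  have hm : ∀ p : Polynomial K, (TrivSqZeroExt.inr p : SS K) ∈ R := by
    intro p
    rw [hRdef]
    exact Algebra.subset_adjoin (by simp)
  refine ⟨?_, ?_⟩
  · intro hfree
    exact not_inj K R hR hm
      (Module.Flat.lTensor_preserves_injective_linearMap _ (Submodule.injective_subtype _))
  · rintro S₀ S₁ - - ⟨-, hflat, -⟩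
    refine not_inj K R hR hm (hflat (oddIdeal K R) R ⊥ ⊤ (evenR K R)
      ((oddIdeal K R).restrictScalars K) (grading_odd K R) (grading_R K R hR)
      (oddIdeal K R).subtype ?_ ?_ (Submodule.injective_subtype _))
    · intro v hv
      rw [Submodule.mem_bot] at hv
      rw [hv]
      simp
    · intro v _
      exact v.2
end
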